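/- arXiv:2208.10110 — 7 statements merged into one kernel-verified Lean document; each statement's English description precedes it below -/
import Mathlib

section
/- Let s, P ≥ 1 and m = 2Ps. Let ς = (ς_1,…,ς_m) and ς′ = (ς′_1,…,ς′_m) be integer sequences, each with pairwise distinct entries, having the same set of entries, and suppose Sum(β(ς)_{(s,1)}) ≡ Sum(β(ς′)_{(s,1)}) (mod 2Ps). If there exist intervals [i, i+s−1] ⊆ [1,m] and [i′, i′+s−1] ⊆ [1,m] such that the burst stable deletion of length s at [i,i+s−1] applied to ς produces the same sequence as the burst stable deletion of length s at [i′,i′+s−1] applied to ς′, then ς_k = ς′_{k′}, where k is the unique element of [i,i+s−1] with k ≡ 1 (mod s) and k′ is the unique element of [i′,i′+s−1] with k′ ≡ 1 (mod s). -/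
namespace Stmt

def sig {α : Type*} [LinearOrder α] (u : ℕ → α) : ℕ → ℕ :=
  fun i => if u i ≤ u (i+1) then 1 else 0

def row1 {α : Type*} (s : ℕ) (u : ℕ → α) : ℕ → α :=
  fun i => u ((i-1)*s + 1)

def betaProj {α : Type*} [LinearOrder α] (u : ℕ → α) (m i : ℕ) : ℕ :=
  ((Finset.Icc 1 m).filter (fun j => u j < u i)).card
  + ((Finset.Icc 1 i).filter (fun j => u j = u i)).card

def blockAt {α : Type*} (u : ℕ → α) (L t k : ℕ) : ℕ → α :=
  fun j => u (((k-1) % t) * L + j)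

def pairBlk {α : Type*} (u : ℕ → α) (L t k : ℕ) : ℕ → α :=
  fun j => if j ≤ L then blockAt u L t k j else blockAt u L t (k+1) (j - L)

def rowSumBeta {α : Type*} [LinearOrder α] (s P : ℕ) (v : ℕ → α) : ℕ :=
  ∑ i ∈ Finset.range (2*P), betaProj v (2*P*s) (i*s+1)

def CRetrieve {α : Type*} [LinearOrder α] (n s P c1 c2 : ℕ) (u : ℕ → α) : Prop :=
  (∑ i ∈ Finset.Icc 1 (n/(2*P*s)),
      rowSumBeta s P (pairBlk u (P*s) (n/(P*s)) (2*i-1))) ≡ c1 [MOD 2*P*s]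
  ∧ (∑ i ∈ Finset.Icc 1 (n/(2*P*s)),
      rowSumBeta s P (pairBlk u (P*s) (n/(P*s)) (2*i))) ≡ c2 [MOD 2*P*s]

def permRank {α : Type*} [LinearOrder α] (u : ℕ → α) (m : ℕ) : ℕ :=
  1 + (((List.range' 1 m).permutations).filter
    (fun l => decide (List.Lex (· < ·) l
      ((List.range' 1 m).map (fun i => betaProj u m i))))).length

def CRecover {α : Type*} [LinearOrder α] (n h d1 d2 : ℕ) (u : ℕ → α) : Prop :=
  (∑ i ∈ Finset.Icc 1 (n/(2*h)), permRank (pairBlk u h (n/h) (2*i-1)) (2*h))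
      ≡ d1 [MOD Nat.factorial (2*h)]
  ∧ (∑ i ∈ Finset.Icc 1 (n/(2*h)), permRank (pairBlk u h (n/h) (2*i)) (2*h))
      ≡ d2 [MOD Nat.factorial (2*h)]

def BurstDelEq {α : Type*} (n s : ℕ) (x y : ℕ → α) (i i' : ℕ) : Prop :=
  ∀ j ∈ Finset.Icc 1 (n - s),
    (if j < i then x j else x (j + s)) = (if j < i' then y j else y (j + s))

def NoRun (m P : ℕ) (y : ℕ → ℕ) : Prop :=
  ∀ i, 1 ≤ i → i + P - 1 ≤ m → ∃ j, i ≤ j ∧ j + 1 ≤ i + P - 1 ∧ y j ≠ y (j+1)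

def seqOf (n : ℕ) (π : Equiv.Perm (Fin n)) : ℕ → ℕ :=
  fun i => if h : i - 1 < n then (π ⟨i-1, h⟩ : ℕ) + 1 else 0

def insSeq (π : ℕ → ℕ) (j v : ℕ) : ℕ → ℕ :=
  fun i => if i ≤ j then π i else if i = j+1 then v else π (i-1)


lemma sum_split (f : ℕ → ℕ) (n q0 : ℕ) (h : q0 ≤ n) :
    ∑ q ∈ Finset.range (n+1), f q
      = f q0 + ∑ q ∈ Finset.range n, (if q < q0 then f q else f (q+1)) := by
  induction n with
  | zero =>
    have : q0 = 0 := by omega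
    subst this
    simp
  | succ n ih =>
    rcases Nat.lt_or_ge n q0 with h1 | h1
    · have : q0 = n + 1 := by omega
      subst this
      rw [Finset.sum_range_succ, add_comm]
      congr 1
      apply Finset.sum_congr rfl
      intro q hq
      rw [if_pos (Finset.mem_range.mp hq)]
    · rw [Finset.sum_range_succ, ih h1, Finset.sum_range_succ _ n, if_neg (by omega)]
      ring

lemma betaProj_eq (u : ℕ → ℤ) (m j : ℕ) (hinj : Set.InjOn u (Set.Icc 1 m))
    (h1 : 1 ≤ j) (h2 : j ≤ m) :
    betaProj u m j = (((Finset.Icc 1 m).image u).filter (fun w => w < u j)).card + 1 := by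
  unfold betaProj
  congr 1
  · rw [Finset.filter_image, Finset.card_image_of_injOn]
    intro x hx y hy hxy
    simp only [Finset.coe_filter, Finset.mem_Icc, Set.mem_setOf_eq] at hx hy
    exact hinj hx.1 hy.1 hxy
  · rw [Finset.card_eq_one]
    refine ⟨j, ?_⟩
    ext x
    simp only [Finset.mem_filter, Finset.mem_Icc, Finset.mem_singleton]
    constructor
    · rintro ⟨⟨h3, h4⟩, h5⟩
      exact hinj ⟨h3, h4.trans h2⟩ ⟨h1, h2⟩ h5
    · rintro rfl
      exact ⟨⟨h1, le_rfl⟩, rfl⟩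

lemma row_sum (s P : ℕ) (hs : 1 ≤ s) (hP : 1 ≤ P) (u : ℕ → ℤ)
    (hinj : Set.InjOn u (Set.Icc 1 (2*P*s)))
    (i k : ℕ) (hi : 1 ≤ i) (hi2 : i + s - 1 ≤ 2*P*s)
    (hk : i ≤ k ∧ k ≤ i + s - 1 ∧ k % s = 1 % s) (R : ℤ → ℕ)
    (hR : ∀ v, R v = (((Finset.Icc 1 (2*P*s)).image u).filter (fun w => w < v)).card) :
    ∑ q ∈ Finset.range (2*P), betaProj u (2*P*s) (q*s+1)
      = R (u k) + (2*P + ∑ q ∈ Finset.range (2*P-1),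
        R (if q*s+1 < i then u (q*s+1) else u (q*s+1+s))) := by
  obtain ⟨hk1, hk2, hk3⟩ := hk
  obtain ⟨q0, hq0⟩ : ∃ q0, k = q0*s+1 := by
    have : s ∣ k - 1 := (Nat.modEq_iff_dvd' (by omega)).mp hk3.symm
    obtain ⟨c, hc⟩ := this
    exact ⟨c, by rw [mul_comm]; omega⟩
  have hq0P : q0 < 2*P := by
    by_contra hcon
    have := Nat.mul_le_mul_right s (not_lt.mp hcon)
    omega
  have e1 : ∑ q ∈ Finset.range (2*P), betaProj u (2*P*s) (q*s+1)
      = ∑ q ∈ Finset.range (2*P), (R (u (q*s+1)) + 1) := by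
    apply Finset.sum_congr rfl
    intro q hq
    have := Nat.mul_le_mul_right s (Nat.succ_le_of_lt (Finset.mem_range.mp hq))
    rw [Nat.succ_mul] at this
    rw [hR, betaProj_eq u _ _ hinj (by omega) (by omega)]
  have e2 := sum_split (fun q => R (u (q*s+1))) (2*P-1) q0 (by omega)
  rw [show 2*P-1+1 = 2*P by omega] at e2
  rw [e1, Finset.sum_add_distrib, e2]
  have e3 : ∑ q ∈ Finset.range (2*P-1), (if q < q0 then R (u (q*s+1)) else R (u ((q+1)*s+1)))
     = ∑ q ∈ Finset.range (2*P-1), R (if q*s+1 < i then u (q*s+1) else u (q*s+1+s)) := by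
    apply Finset.sum_congr rfl
    intro q hq
    by_cases h : q < q0
    · have := Nat.mul_le_mul_right s (Nat.succ_le_of_lt h)
      rw [Nat.succ_mul] at this
      rw [if_pos h, if_pos (by omega)]
    · have := Nat.mul_le_mul_right s (not_lt.mp h)
      rw [if_neg h, if_neg (by omega)]
      congr 2
      ring
  simp only [e3, hq0, Finset.sum_const, Finset.card_range, smul_eq_mul, mul_one]
  ring

/-- Lemma: retrieve the missing symbol of the first row from the block. -/
theorem stmt1 (s P : ℕ) (hs : 1 ≤ s) (hP : 1 ≤ P)
    (ς ς' : ℕ → ℤ)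
    (hinj : Set.InjOn ς (Set.Icc 1 (2*P*s)))
    (hinj' : Set.InjOn ς' (Set.Icc 1 (2*P*s)))
    (hset : (Finset.Icc 1 (2*P*s)).image ς = (Finset.Icc 1 (2*P*s)).image ς')
    (hsum : (∑ i ∈ Finset.range (2*P), betaProj ς (2*P*s) (i*s+1))
          ≡ (∑ i ∈ Finset.range (2*P), betaProj ς' (2*P*s) (i*s+1)) [MOD 2*P*s])
    (i i' : ℕ) (hi : 1 ≤ i) (hi2 : i + s - 1 ≤ 2*P*s)
    (hi' : 1 ≤ i') (hi2' : i' + s - 1 ≤ 2*P*s)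
    (hdel : BurstDelEq (2*P*s) s ς ς' i i')
    (k k' : ℕ)
    (hk : i ≤ k ∧ k ≤ i + s - 1 ∧ k % s = 1 % s)
    (hk' : i' ≤ k' ∧ k' ≤ i' + s - 1 ∧ k' % s = 1 % s) :
    ς k = ς' k' := by
  set S := (Finset.Icc 1 (2*P*s)).image ς with hS
  let R : ℤ → ℕ := fun v => (S.filter (fun w => w < v)).card
  have r1 := row_sum s P hs hP ς hinj i k hi hi2 hk R (fun v => rfl)
  have r2 := row_sum s P hs hP ς' hinj' i' k' hi' hi2' hk' R (fun v => by rw [← hset])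
  have e : ∑ q ∈ Finset.range (2*P-1), R (if q*s+1 < i then ς (q*s+1) else ς (q*s+1+s))
      = ∑ q ∈ Finset.range (2*P-1), R (if q*s+1 < i' then ς' (q*s+1) else ς' (q*s+1+s)) := by
    apply Finset.sum_congr rfl
    intro q hq
    have hq := Finset.mem_range.mp hq
    have := Nat.mul_le_mul_right s (show q + 1 + 1 ≤ 2*P by omega)
    rw [Nat.succ_mul, Nat.succ_mul] at this
    rw [hdel (q*s+1) (Finset.mem_Icc.mpr ⟨by omega, by omega⟩)]
  rw [r1, r2, e] at hsum
  have hmod := Nat.ModEq.add_right_cancel' _ hsum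
  have hkS : ς k ∈ S := Finset.mem_image_of_mem _ (Finset.mem_Icc.mpr ⟨by omega, by omega⟩)
  have hkS' : ς' k' ∈ S := by
    rw [hset]
    exact Finset.mem_image_of_mem _ (Finset.mem_Icc.mpr ⟨by omega, by omega⟩)
  have hcard : S.card ≤ 2*P*s := Finset.card_image_le.trans (by simp)
  have mono : ∀ v ∈ S, ∀ w, v < w → R v < R w := by
    intro v hv w hvw
    apply Finset.card_lt_card
    refine ⟨?_, ?_⟩
    · intro x hx
      rw [Finset.mem_filter] at hx ⊢
      exact ⟨hx.1, hx.2.trans hvw⟩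
    · intro h
      have := h (Finset.mem_filter.mpr ⟨hv, hvw⟩)
      exact lt_irrefl _ (Finset.mem_filter.mp this).2
  have lt : ∀ v ∈ S, R v < 2*P*s := by
    intro v hv
    refine lt_of_lt_of_le (Finset.card_lt_card ⟨Finset.filter_subset _ _, ?_⟩) hcard
    intro h
    exact lt_irrefl _ (Finset.mem_filter.mp (h hv)).2
  have heq := Nat.ModEq.eq_of_lt_of_lt hmod (lt _ hkS) (lt _ hkS')
  rcases lt_trichotomy (ς k) (ς' k') with h | h | h
  · exact absurd heq (mono _ hkS _ h).ne
  · exact h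
  · exact absurd heq (mono _ hkS' _ h).ne'

end Stmt
end

section
/- Let s, P ≥ 1 and let n be a multiple of 2Ps. Let σ and τ be integer sequences of length n that both lie in C^retrieve_{c1,c2}(n,s,P) for the same c1, c2 ∈ {0,…,2Ps−1}. If there exists k ∈ {1,…,n/(Ps)−1} such that σ(s,P,i) = τ(s,P,i) for every i ∈ {1,…,n/(Ps)} \ {k, k+1}, then Sum(β(σ(s,P,k),σ(s,P,k+1))_{(s,1)}) ≡ Sum(β(τ(s,P,k),τ(s,P,k+1))_{(s,1)}) (mod 2Ps). -/
namespace Stmt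

theorem rowSumBeta_congr_aux (s P : ℕ) (hs : 1 ≤ s) (v w : ℕ → ℤ)
    (h : ∀ j, 1 ≤ j → j ≤ 2*P*s → v j = w j) : rowSumBeta s P v = rowSumBeta s P w := by
  unfold rowSumBeta
  refine Finset.sum_congr rfl fun i hi => ?_
  have hi := Finset.mem_range.mp hi
  have hle : i*s+1 ≤ 2*P*s := by
    have : (i+1)*s ≤ 2*P*s := Nat.mul_le_mul_right s hi
    nlinarith
  have h0 := h (i*s+1) (by omega) hle
  unfold betaProj
  congr 2
  · refine Finset.filter_congr fun j hj => ?_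
    have hj := Finset.mem_Icc.mp hj
    rw [h0, h j hj.1 hj.2]
  · refine Finset.filter_congr fun j hj => ?_
    have hj := Finset.mem_Icc.mp hj
    rw [h0, h j hj.1 (by omega)]

theorem sum_cancel_aux (q m c a : ℕ) (f g : ℕ → ℕ) (ha : a ∈ Finset.Icc 1 q)
    (hf : ∑ i ∈ Finset.Icc 1 q, f i ≡ c [MOD m]) (hg : ∑ i ∈ Finset.Icc 1 q, g i ≡ c [MOD m])
    (h : ∀ i ∈ Finset.Icc 1 q, i ≠ a → f i = g i) : f a ≡ g a [MOD m] := by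
  have h1 := hf.trans hg.symm
  rw [← Finset.add_sum_erase _ _ ha, ← Finset.add_sum_erase _ g ha] at h1
  have h2 : ∑ i ∈ (Finset.Icc 1 q).erase a, f i = ∑ i ∈ (Finset.Icc 1 q).erase a, g i :=
    Finset.sum_congr rfl fun i hi =>
      h i (Finset.mem_of_mem_erase hi) (Finset.ne_of_mem_erase hi)
  rw [h2] at h1
  exact Nat.ModEq.add_right_cancel' _ h1

/-- Lemma: the value c for the erroneous pair of blocks is determined
by membership in C^retrieve. -/
theorem stmt2 (s P n : ℕ) (hs : 1 ≤ s) (hP : 1 ≤ P) (hn : 2*P*s ∣ n)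
    (c1 c2 : ℕ) (hc1 : c1 < 2*P*s) (hc2 : c2 < 2*P*s)
    (σ τ : ℕ → ℤ)
    (hσ : CRetrieve n s P c1 c2 σ) (hτ : CRetrieve n s P c1 c2 τ)
    (k : ℕ) (hk1 : 1 ≤ k) (hk2 : k ≤ n/(P*s) - 1)
    (heq : ∀ i, 1 ≤ i → i ≤ n/(P*s) → i ≠ k → i ≠ k+1 →
      ∀ j, 1 ≤ j → j ≤ P*s → σ ((i-1)*(P*s) + j) = τ ((i-1)*(P*s) + j)) :
    rowSumBeta s P (pairBlk σ (P*s) (n/(P*s)) k)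
      ≡ rowSumBeta s P (pairBlk τ (P*s) (n/(P*s)) k) [MOD 2*P*s] := by
  obtain ⟨q, rfl⟩ := hn
  have hL : 0 < P*s := Nat.mul_pos hP hs
  have e1 : 2*P*s*q/(2*P*s) = q := Nat.mul_div_cancel_left q (by rw [mul_assoc]; omega)
  have e2 : 2*P*s*q/(P*s) = 2*q := by
    rw [show 2*P*s*q = P*s*(2*q) by ring]
    exact Nat.mul_div_cancel_left _ hL
  unfold CRetrieve at hσ hτ
  rw [e1, e2] at hσ hτ
  rw [e2] at hk2 heq ⊢
  have blk : ∀ b, b < 2*q → b + 1 ≠ k → b ≠ k → ∀ j, 1 ≤ j → j ≤ P*s →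
      σ (b*(P*s)+j) = τ (b*(P*s)+j) := by
    intro b hb h1 h2 j hj hj'
    have := heq (b+1) (by omega) (by omega) h1 (by omega) j hj hj'
    simpa using this
  have key : ∀ k', 1 ≤ k' → k' ≤ 2*q → k' % 2 = k % 2 → k' ≠ k →
      rowSumBeta s P (pairBlk σ (P*s) (2*q) k') = rowSumBeta s P (pairBlk τ (P*s) (2*q) k') := by
    intro k' h1 h2 h3 h4
    apply rowSumBeta_congr_aux s P hs
    intro j hj hj'
    rw [mul_assoc] at hj'
    unfold pairBlk blockAt
    split_ifs with hjL
    · rw [Nat.mod_eq_of_lt (by omega : k' - 1 < 2*q)]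
      exact blk _ (by omega) (by omega) (by omega) j hj hjL
    · rw [Nat.add_sub_cancel]
      rcases Nat.lt_or_ge k' (2*q) with hlt | hge
      · rw [Nat.mod_eq_of_lt hlt]
        exact blk _ (by omega) (by omega) (by omega) _ (by omega) (by omega)
      · obtain rfl : k' = 2*q := by omega
        rw [Nat.mod_self]
        exact blk _ (by omega) (by omega) (by omega) _ (by omega) (by omega)
  rcases Nat.even_or_odd' k with ⟨a, rfl | rfl⟩
  · exact sum_cancel_aux q _ c2 a
      (fun i => rowSumBeta s P (pairBlk σ (P*s) (2*q) (2*i)))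
      (fun i => rowSumBeta s P (pairBlk τ (P*s) (2*q) (2*i)))
      (Finset.mem_Icc.mpr (by omega)) hσ.2 hτ.2 (by
        intro i hi hne
        have := Finset.mem_Icc.mp hi
        exact key _ (by omega) (by omega) (by omega) (by omega))
  · exact sum_cancel_aux q _ c1 (a+1)
      (fun i => rowSumBeta s P (pairBlk σ (P*s) (2*q) (2*i-1)))
      (fun i => rowSumBeta s P (pairBlk τ (P*s) (2*q) (2*i-1)))
      (Finset.mem_Icc.mpr (by omega)) hσ.1 hτ.1 (by
        intro i hi hne
        have := Finset.mem_Icc.mp hi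
        exact key _ (by omega) (by omega) (by omega) (by omega))

end Stmt
end

section
/- Let s ≥ 1, n = st, P = ⌈log₂(4n/s)⌉, and assume 2Ps divides n. Let σ and τ be permutations of {1,…,n} (viewed as sequences) both lying in C^retrieve_{c1,c2}(n,s,P) for the same c1, c2 ∈ {0,…,2Ps−1}. Suppose the burst stable deletion of length s at [i,i+s−1] applied to σ produces the same sequence as the burst stable deletion of length s at [i′,i′+s−1] applied to τ. Let k (resp. k′) be the unique element of [i,i+s−1] (resp. [i′,i′+s−1]) congruent to 1 modulo s, and let j = (k−1)/s + 1 and j′ = (k′−1)/s + 1 be the corresponding column indices. If |j − j′| ≤ P−1, then σ_k = τ_{k′}, i.e., the missing symbol of the first row is uniquely determined. -/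
namespace Stmt

theorem betaProj_congr (u v : ℕ → ℕ) (m i : ℕ) (hi : 1 ≤ i) (him : i ≤ m)
    (h : ∀ j, 1 ≤ j → j ≤ m → u j = v j) : betaProj u m i = betaProj v m i := by
  unfold betaProj
  congr 2
  · apply Finset.filter_congr
    intro x hx
    rw [Finset.mem_Icc] at hx
    rw [h x hx.1 hx.2, h i hi him]
  · apply Finset.filter_congr
    intro x hx
    rw [Finset.mem_Icc] at hx
    rw [h x hx.1 (hx.2.trans him), h i hi him]

theorem col_le (s P r : ℕ) (hs : 1 ≤ s) (hr : r < 2*P) : r*s+1 ≤ 2*P*s := by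
  have : (r+1)*s ≤ 2*P*s := Nat.mul_le_mul_right s hr
  nlinarith

theorem rowSum_congr (s P : ℕ) (hs : 1 ≤ s) (u v : ℕ → ℕ)
    (h : ∀ j, 1 ≤ j → j ≤ 2*P*s → u j = v j) : rowSumBeta s P u = rowSumBeta s P v := by
  unfold rowSumBeta
  apply Finset.sum_congr rfl
  intro r hr
  rw [Finset.mem_range] at hr
  exact betaProj_congr u v _ _ (by omega) (col_le s P r hs hr) h

def rk (V : Finset ℕ) (x : ℕ) : ℕ := (V.filter (fun y => y < x)).card

theorem betaProj_rk (u : ℕ → ℕ) (m i : ℕ) (hi : 1 ≤ i) (him : i ≤ m)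
    (hinj : Set.InjOn u (Finset.Icc 1 m)) :
    betaProj u m i = rk ((Finset.Icc 1 m).image u) (u i) + 1 := by
  unfold betaProj rk
  congr 1
  · rw [Finset.filter_image, Finset.card_image_of_injOn]
    exact hinj.mono (by intro x hx; simp at hx ⊢; exact hx.1)
  · rw [Finset.card_eq_one]
    refine ⟨i, ?_⟩
    ext x
    simp only [Finset.mem_filter, Finset.mem_Icc, Finset.mem_singleton]
    constructor
    · rintro ⟨⟨h1, h2⟩, h3⟩
      exact hinj (by simp; omega) (by simp; omega) h3
    · rintro rfl
      exact ⟨⟨hi, le_rfl⟩, rfl⟩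

theorem rk_lt_card (V : Finset ℕ) (x : ℕ) (hx : x ∈ V) : rk V x < V.card := by
  apply Finset.card_lt_card
  rw [Finset.filter_ssubset]
  exact ⟨x, hx, by simp⟩

theorem rk_lt (V : Finset ℕ) (x y : ℕ) (hx : x ∈ V) (h : x < y) : rk V x < rk V y := by
  apply Finset.card_lt_card
  rw [Finset.ssubset_iff_of_subset]
  · exact ⟨x, by simp [hx, h], by simp⟩
  · intro z hz
    simp only [Finset.mem_filter] at hz ⊢
    exact ⟨hz.1, hz.2.trans h⟩

theorem rk_inj (V : Finset ℕ) (x y : ℕ) (hx : x ∈ V) (hy : y ∈ V) (h : rk V x = rk V y) :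
    x = y := by
  rcases lt_trichotomy x y with h1 | h1 | h1
  · have := rk_lt V x y hx h1
    omega
  · exact h1
  · have := rk_lt V y x hy h1
    omega

theorem sum_remove (f : ℕ → ℕ) (m a : ℕ) (ha : a < m + 1) :
    ∑ r ∈ Finset.range (m+1), f r
      = f a + ∑ r ∈ Finset.range m, (if r < a then f r else f (r+1)) := by
  rw [Finset.sum_range, Fin.sum_univ_succAbove _ (⟨a, ha⟩ : Fin (m+1)), Finset.sum_range]
  congr 1
  apply Finset.sum_congr rfl
  intro r _
  by_cases h : (r : ℕ) < a
  · rw [if_pos h, Fin.succAbove_of_castSucc_lt _ _ (by simpa [Fin.lt_def] using h)]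
    simp
  · rw [if_neg h, Fin.succAbove_of_le_castSucc _ _ (by simpa [Fin.le_def] using h)]
    simp

theorem core (s P : ℕ) (hs : 1 ≤ s) (hP : 1 ≤ P) (u v : ℕ → ℕ)
    (hu : Set.InjOn u (Finset.Icc 1 (2*P*s))) (hv : Set.InjOn v (Finset.Icc 1 (2*P*s)))
    (himg : (Finset.Icc 1 (2*P*s)).image u = (Finset.Icc 1 (2*P*s)).image v)
    (a a' : ℕ) (ha : a < 2*P) (ha' : a' < 2*P)
    (hrow : ∀ r < 2*P-1, (if r < a then u (r*s+1) else u ((r+1)*s+1))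
      = (if r < a' then v (r*s+1) else v ((r+1)*s+1)))
    (hmod : rowSumBeta s P u ≡ rowSumBeta s P v [MOD 2*P*s]) :
    u (a*s+1) = v (a'*s+1) := by
  set V := (Finset.Icc 1 (2*P*s)).image u with hV
  obtain ⟨m, hm⟩ : ∃ m, 2*P = m+1 := ⟨2*P-1, by omega⟩
  have e1 : rowSumBeta s P u = ∑ r ∈ Finset.range (2*P), (rk V (u (r*s+1)) + 1) := by
    unfold rowSumBeta
    apply Finset.sum_congr rfl
    intro r hr
    rw [Finset.mem_range] at hr
    exact betaProj_rk u _ _ (by omega) (col_le s P r hs hr) hu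
  have e2 : rowSumBeta s P v = ∑ r ∈ Finset.range (2*P), (rk V (v (r*s+1)) + 1) := by
    unfold rowSumBeta
    apply Finset.sum_congr rfl
    intro r hr
    rw [Finset.mem_range] at hr
    rw [himg]
    exact betaProj_rk v _ _ (by omega) (col_le s P r hs hr) hv
  have hcard : V.card = 2*P*s := by
    rw [hV, Finset.card_image_of_injOn hu]; simp
  have hmemu : u (a*s+1) ∈ V :=
    Finset.mem_image_of_mem _ (by have := col_le s P a hs ha; simp; omega)
  have hmemv : v (a'*s+1) ∈ V := by
    rw [himg]
    exact Finset.mem_image_of_mem _ (by have := col_le s P a' hs ha'; simp; omega)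
  have e3 : ∑ r ∈ Finset.range m, (if r < a then (rk V (u (r*s+1)) + 1)
        else (rk V (u ((r+1)*s+1)) + 1))
      = ∑ r ∈ Finset.range m, (if r < a' then (rk V (v (r*s+1)) + 1)
        else (rk V (v ((r+1)*s+1)) + 1)) := by
    apply Finset.sum_congr rfl
    intro r hr
    rw [Finset.mem_range] at hr
    have := congrArg (fun x => rk V x + 1) (hrow r (by omega))
    simpa only [apply_ite (fun x => rk V x + 1)] using this
  rw [e1, e2, hm, sum_remove _ m a (by omega), sum_remove _ m a' (by omega), e3, ← hm] at hmod
  have h4 := Nat.ModEq.add_right_cancel' _ (Nat.ModEq.add_right_cancel' _ hmod)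
  apply rk_inj V _ _ hmemu hmemv
  apply Nat.ModEq.eq_of_lt_of_lt h4
  · rw [← hcard]; exact rk_lt_card _ _ hmemu
  · rw [← hcard]; exact rk_lt_card _ _ hmemv

theorem sum_mod_cancel (S : Finset ℕ) (f g : ℕ → ℕ) (i0 M : ℕ) (h0 : i0 ∈ S)
    (h : ∀ i ∈ S, i ≠ i0 → f i = g i) (hm : ∑ i ∈ S, f i ≡ ∑ i ∈ S, g i [MOD M]) :
    f i0 ≡ g i0 [MOD M] := by
  rw [← Finset.add_sum_erase S f h0, ← Finset.add_sum_erase S g h0,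
    Finset.sum_congr rfl (g := g) (s₁ := S.erase i0)
      (fun x hx => h x (Finset.mem_of_mem_erase hx) (Finset.ne_of_mem_erase hx))] at hm
  exact Nat.ModEq.add_right_cancel' _ hm

theorem pairBlk_window (u : ℕ → ℕ) (L T b j : ℕ) (hb : b + 2 ≤ T) :
    pairBlk u L T (b+1) j = u (b*L + j) := by
  unfold pairBlk blockAt
  split_ifs with h
  · rw [Nat.add_sub_cancel, Nat.mod_eq_of_lt (by omega)]
  · rw [show b+1+1-1 = b+1 by omega, Nat.mod_eq_of_lt (by omega)]
    congr 1
    rw [Nat.add_mul]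
    omega

theorem block_disj (L c b j : ℕ) (h1 : 1 ≤ j) (h2 : j ≤ L) (hc : c ≠ b) (hc' : c ≠ b+1) :
    c*L+j ≤ b*L ∨ (b+2)*L < c*L+j := by
  rcases lt_or_ge c b with h | h
  · left
    have : (c+1)*L ≤ b*L := Nat.mul_le_mul_right L h
    nlinarith
  · right
    have : (b+2)*L ≤ c*L := Nat.mul_le_mul_right L (by omega)
    omega

theorem block_le (L c T j : ℕ) (h2 : j ≤ L) (hc : c < T) : c*L+j ≤ T*L := by
  have : (c+1)*L ≤ T*L := Nat.mul_le_mul_right L hc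
  nlinarith

theorem pairBlk_other (u v : ℕ → ℕ) (L N b q j : ℕ) (hb : b + 2 ≤ 2*N)
    (hq : 1 ≤ q) (hqT : q ≤ 2*N) (hpar : q % 2 = (b+1) % 2) (hne : q ≠ b+1)
    (h : ∀ p, 1 ≤ p → p ≤ 2*N*L → (p ≤ b*L ∨ (b+2)*L < p) → u p = v p)
    (hj : 1 ≤ j) (hj2 : j ≤ 2*L) :
    pairBlk u L (2*N) q j = pairBlk v L (2*N) q j := by
  unfold pairBlk blockAt
  split_ifs with hl
  · rw [Nat.mod_eq_of_lt (by omega)]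
    exact h _ (by omega) (block_le _ _ _ _ hl (by omega))
      (block_disj L (q-1) b j hj hl (by omega) (by omega))
  · have hc : (q+1-1) % (2*N) < 2*N := Nat.mod_lt _ (by omega)
    have hc2 : (q+1-1) % (2*N) ≠ b ∧ (q+1-1) % (2*N) ≠ b+1 := by
      rw [Nat.add_sub_cancel]
      rcases hqT.lt_or_eq with hlt | heq
      · rw [Nat.mod_eq_of_lt hlt]; omega
      · rw [heq, Nat.mod_self]; omega
    exact h _ (by omega) (block_le _ _ _ _ (by omega) hc)
      (block_disj L _ b (j-L) (by omega) (by omega) hc2.1 hc2.2)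

theorem image_window (n w m : ℕ) (σ τ : ℕ → ℕ) (hm : w + m ≤ n)
    (hσ : Set.BijOn σ (Set.Icc 1 n) (Set.Icc 1 n))
    (hτ : Set.BijOn τ (Set.Icc 1 n) (Set.Icc 1 n))
    (h : ∀ p, 1 ≤ p → p ≤ n → (p ≤ w ∨ w + m < p) → σ p = τ p) :
    (Finset.Icc 1 m).image (fun j => σ (w+j)) ⊆ (Finset.Icc 1 m).image (fun j => τ (w+j)) := by
  intro y hy
  simp only [Finset.mem_image, Finset.mem_Icc] at hy ⊢
  obtain ⟨j, hj, rfl⟩ := hy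
  obtain ⟨p, hp, hpe⟩ := hτ.surjOn (hσ.mapsTo (show w + j ∈ Set.Icc 1 n from
    ⟨by omega, by omega⟩))
  have hp1 := hp.1
  have hp2 := hp.2
  by_cases hc : p ≤ w ∨ w + m < p
  · rw [← h p hp1 hp2 hc] at hpe
    have := hσ.injOn hp (show w + j ∈ Set.Icc 1 n from ⟨by omega, by omega⟩) hpe
    omega
  · refine ⟨p - w, by omega, ?_⟩
    rw [show w + (p-w) = p by omega]
    exact hpe

theorem injOn_window (n w m : ℕ) (σ : ℕ → ℕ) (hm : w + m ≤ n)
    (hσ : Set.BijOn σ (Set.Icc 1 n) (Set.Icc 1 n)) :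
    Set.InjOn (fun j => σ (w+j)) (Finset.Icc 1 m) := by
  intro x hx y hy hxy
  simp only [Finset.coe_Icc, Set.mem_Icc] at hx hy
  have := hσ.injOn (show w + x ∈ Set.Icc 1 n from ⟨by omega, by omega⟩)
    (show w + y ∈ Set.Icc 1 n from ⟨by omega, by omega⟩) hxy
  omega

theorem lt_start_iff (s r x i : ℕ) (h1 : i ≤ r*s+1) (h2 : r*s+1 ≤ i+s-1) (hi : 1 ≤ i) :
    x*s+1 < i ↔ x < r := by
  constructor
  · intro h
    by_contra hc
    have : r*s ≤ x*s := Nat.mul_le_mul_right s (by omega)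
    omega
  · intro h
    have : (x+1)*s ≤ r*s := Nat.mul_le_mul_right s h
    rw [Nat.add_mul] at this
    omega

theorem main_aux (s n P N b : ℕ) (hs : 1 ≤ s) (hP : 1 ≤ P) (hn : n = 2*P*s*N)
    (hb : b + 2 ≤ 2*N) (c1 c2 : ℕ) (σ τ : ℕ → ℕ)
    (hσperm : Set.BijOn σ (Set.Icc 1 n) (Set.Icc 1 n))
    (hτperm : Set.BijOn τ (Set.Icc 1 n) (Set.Icc 1 n))
    (hσ : CRetrieve n s P c1 c2 σ) (hτ : CRetrieve n s P c1 c2 τ)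
    (h : ∀ p, 1 ≤ p → p ≤ n → (p ≤ b*(P*s) ∨ (b+2)*(P*s) < p) → σ p = τ p)
    (a a' : ℕ) (ha : a < 2*P) (ha' : a' < 2*P)
    (hrow : ∀ r < 2*P-1,
      (if r < a then σ (b*(P*s)+(r*s+1)) else σ (b*(P*s)+((r+1)*s+1)))
      = (if r < a' then τ (b*(P*s)+(r*s+1)) else τ (b*(P*s)+((r+1)*s+1)))) :
    σ (b*(P*s)+(a*s+1)) = τ (b*(P*s)+(a'*s+1)) := by
  have hL : 0 < P*s := Nat.mul_pos hP hs
  have hwn : b*(P*s) + 2*P*s ≤ n := by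
    have : (b+2)*(P*s) ≤ (2*N)*(P*s) := Nat.mul_le_mul_right _ hb
    rw [hn]; nlinarith
  have hww : b*(P*s) + 2*P*s = (b+2)*(P*s) := by ring
  have hN1 : n/(2*P*s) = N := by
    rw [hn]; exact Nat.mul_div_cancel_left _ (by rw [Nat.mul_assoc]; omega)
  have hN2 : n/(P*s) = 2*N := by
    rw [hn, show 2*P*s*N = (P*s)*(2*N) by ring]; exact Nat.mul_div_cancel_left _ hL
  have hout : ∀ q, 1 ≤ q → q ≤ 2*N → q % 2 = (b+1) % 2 → q ≠ b+1 →
      rowSumBeta s P (pairBlk σ (P*s) (2*N) q) = rowSumBeta s P (pairBlk τ (P*s) (2*N) q) := by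
    intro q h1 h2 h3 h4
    apply rowSum_congr s P hs
    intro j hj hj2
    apply pairBlk_other σ τ (P*s) N b q j hb h1 h2 h3 h4 _ hj (by rw [← Nat.mul_assoc]; exact hj2)
    intro p hp hp2 hp3
    exact h p hp (by rw [hn]; nlinarith) hp3
  have hmod : rowSumBeta s P (pairBlk σ (P*s) (2*N) (b+1))
      ≡ rowSumBeta s P (pairBlk τ (P*s) (2*N) (b+1)) [MOD 2*P*s] := by
    unfold CRetrieve at hσ hτ
    rw [hN1, hN2] at hσ hτ
    rcases Nat.even_or_odd' b with ⟨e, he | he⟩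
    · have hm := hσ.1.trans hτ.1.symm
      have := sum_mod_cancel _ _ _ (e+1) _ (by simp; omega) (by
        intro x hx hxe
        rw [Finset.mem_Icc] at hx
        exact hout _ (by omega) (by omega) (by omega) (by omega)) hm
      rwa [show 2*(e+1)-1 = b+1 by omega] at this
    · have hm := hσ.2.trans hτ.2.symm
      have := sum_mod_cancel _ _ _ (e+1) _ (by simp; omega) (by
        intro x hx hxe
        rw [Finset.mem_Icc] at hx
        exact hout _ (by omega) (by omega) (by omega) (by omega)) hm
      rwa [show 2*(e+1) = b+1 by omega] at this
  rw [show pairBlk σ (P*s) (2*N) (b+1) = fun j => σ (b*(P*s)+j) from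
      funext fun j => pairBlk_window σ _ _ b j hb,
    show pairBlk τ (P*s) (2*N) (b+1) = fun j => τ (b*(P*s)+j) from
      funext fun j => pairBlk_window τ _ _ b j hb] at hmod
  have h' : ∀ p, 1 ≤ p → p ≤ n → (p ≤ b*(P*s) ∨ b*(P*s)+2*P*s < p) → σ p = τ p := by
    rw [hww]; exact h
  exact core s P hs hP (fun j => σ (b*(P*s)+j)) (fun j => τ (b*(P*s)+j))
    (injOn_window n _ _ σ hwn hσperm) (injOn_window n _ _ τ hwn hτperm)
    (Finset.Subset.antisymm (image_window n _ _ σ τ hwn hσperm hτperm h')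
      (image_window n _ _ τ σ hwn hτperm hσperm (fun p x y z => (h' p x y z).symm)))
    a a' ha ha' hrow hmod

theorem exists_window (P N r r' : ℕ) (hP : 1 ≤ P) (hr : r < 2*P*N) (hr' : r' < 2*P*N)
    (h1 : r < r' + P) (h2 : r' < r + P) :
    ∃ b, b + 2 ≤ 2*N ∧ r < b*P+2*P ∧ r' < b*P+2*P ∧
      (b = 0 ∨ (b*P+1 ≤ r ∧ b*P+1 ≤ r')) := by
  have hN : 1 ≤ N := by
    rcases Nat.eq_zero_or_pos N with h | h
    · simp [h] at hr
    · exact h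
  have hM1 := Nat.div_add_mod (max r r') P
  have hM2 := Nat.mod_lt (max r r') hP
  have hB : max r r' / P < 2*N := by
    rw [Nat.div_lt_iff_lt_mul hP]
    have : 2*N*P = 2*P*N := by ring
    omega
  generalize max r r' / P = B at hM1 hB
  generalize max r r' % P = R at hM1 hM2
  rcases B with _ | B
  · refine ⟨0, by omega, ?_, ?_, Or.inl rfl⟩ <;> simp at hM1 ⊢ <;> omega
  · refine ⟨B, by omega, ?_, ?_, Or.inr ⟨?_, ?_⟩⟩ <;>
      (have : P*(B+1) = B*P+P := by ring) <;> omega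

theorem bounds (s P b r i : ℕ) (hs : 1 ≤ s) (hi : 1 ≤ i) (h1 : i ≤ r*s+1)
    (h2 : r*s+1 ≤ i+s-1) (hr : r < b*P+2*P) (hb : b = 0 ∨ b*P+1 ≤ r) :
    b*(P*s) < i ∧ i + s - 1 ≤ (b+2)*(P*s) ∧ b*P ≤ r := by
  refine ⟨?_, ?_, ?_⟩
  · rcases hb with h | h
    · simp [h]; omega
    · have : (b*P+1)*s ≤ r*s := Nat.mul_le_mul_right s h
      have e : (b*P+1)*s = b*(P*s) + s := by ring
      omega
  · have : (r+1)*s ≤ (b*P+2*P)*s := Nat.mul_le_mul_right s hr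
    have e : (b*P+2*P)*s = (b+2)*(P*s) := by ring
    have e' : (r+1)*s = r*s+s := by ring
    omega
  · rcases hb with h | h
    · simp [h]
    · omega

/-- Theorem: for permutations in C^retrieve, the missing symbol of the
first row is uniquely determined when the erroneous columns are within distance P−1. -/
theorem stmt3 (s t n : ℕ) (hs : 1 ≤ s) (hn : n = s * t)
    (P : ℕ) (hP : P = Nat.clog 2 (4*n/s)) (hdvd : 2*P*s ∣ n)
    (c1 c2 : ℕ) (hc1 : c1 < 2*P*s) (hc2 : c2 < 2*P*s)
    (σ τ : ℕ → ℕ)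
    (hσperm : Set.BijOn σ (Set.Icc 1 n) (Set.Icc 1 n))
    (hτperm : Set.BijOn τ (Set.Icc 1 n) (Set.Icc 1 n))
    (hσ : CRetrieve n s P c1 c2 σ) (hτ : CRetrieve n s P c1 c2 τ)
    (i i' : ℕ) (hi : 1 ≤ i) (hi2 : i + s - 1 ≤ n)
    (hi' : 1 ≤ i') (hi2' : i' + s - 1 ≤ n)
    (hdel : BurstDelEq n s σ τ i i')
    (k k' j j' : ℕ)
    (hk : i ≤ k ∧ k ≤ i + s - 1 ∧ k % s = 1 % s)
    (hk' : i' ≤ k' ∧ k' ≤ i' + s - 1 ∧ k' % s = 1 % s)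
    (hj : j = (k-1)/s + 1) (hj' : j' = (k'-1)/s + 1)
    (hclose : |(j : ℤ) - (j' : ℤ)| ≤ (P : ℤ) - 1) :
    σ k = τ k' := by
  have hP1 : 1 ≤ P := by
    have := abs_nonneg ((j:ℤ) - j')
    omega
  obtain ⟨N, hN⟩ := hdvd
  obtain ⟨hk1, hk2, hk3⟩ := hk
  obtain ⟨hk1', hk2', hk3'⟩ := hk'
  have hkr : ∀ x, 1 ≤ x → x % s = 1 % s → x = (x-1)/s*s+1 := by
    intro x hx hm
    have hd : s ∣ x - 1 := (Nat.modEq_iff_dvd' hx).1 hm.symm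
    have := Nat.div_mul_cancel hd
    omega
  have ek := hkr k (by omega) hk3
  have ek' := hkr k' (by omega) hk3'
  generalize (k-1)/s = r at hj ek
  generalize (k'-1)/s = r' at hj' ek'
  subst ek ek' hj hj'
  rw [abs_le] at hclose
  have hrN : ∀ x, x*s+1 ≤ n → x < 2*P*N := by
    intro x hx
    by_contra hc
    have : 2*P*N*s ≤ x*s := Nat.mul_le_mul_right s (by omega)
    have e : 2*P*N*s = n := by rw [hN]; ring
    omega
  obtain ⟨b, hb, hr, hr', hbb⟩ := exists_window P N r r' hP1 (hrN r (by omega))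
    (hrN r' (by omega)) (by push_cast at hclose; omega) (by push_cast at hclose; omega)
  obtain ⟨w1, w2, w3⟩ := bounds s P b r i hs hi hk1 hk2 hr (by tauto)
  obtain ⟨w1', w2', w3'⟩ := bounds s P b r' i' hs hi' hk1' hk2' hr' (by tauto)
  have hwn : (b+2)*(P*s) ≤ n := by
    have : (b+2)*(P*s) ≤ (2*N)*(P*s) := Nat.mul_le_mul_right _ hb
    have e : (2*N)*(P*s) = n := by rw [hN]; ring
    omega
  have hcol : ∀ x, b*(P*s) + (x*s+1) = (b*P+x)*s+1 := by intro x; ring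
  have key := main_aux s n P N b hs hP1 hN hb c1 c2 σ τ hσperm hτperm hσ hτ (by
    intro p hp hpn hpo
    rcases hpo with hp1 | hp1
    · have := hdel p (by rw [Finset.mem_Icc]; omega)
      rwa [if_pos (by omega), if_pos (by omega)] at this
    · have := hdel (p-s) (by rw [Finset.mem_Icc]; omega)
      rwa [if_neg (by omega), if_neg (by omega), show p - s + s = p by omega] at this)
    (r - b*P) (r' - b*P) (by omega) (by omega) (by
    intro x hx
    simp only [hcol]
    have hle : (b*P+x)*s+1 ≤ n - s := by
      have : (b*P+x+2)*s ≤ (b*P+2*P)*s := Nat.mul_le_mul_right s (by omega)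
      have e : (b*P+2*P)*s = (b+2)*(P*s) := by ring
      have e' : (b*P+x+2)*s = (b*P+x)*s+2*s := by ring
      omega
    have := hdel ((b*P+x)*s+1) (by rw [Finset.mem_Icc]; omega)
    simp only [lt_start_iff s r _ i hk1 hk2 hi, lt_start_iff s r' _ i' hk1' hk2' hi'] at this
    have e1 : (b*P+x < r) ↔ (x < r - b*P) := by omega
    have e2 : (b*P+x < r') ↔ (x < r' - b*P) := by omega
    simp only [e1, e2] at this
    rwa [show (b*P+x)*s+1+s = (b*P+(x+1))*s+1 by ring] at this)
  simp only [hcol] at key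
  rwa [show b*P + (r - b*P) = r by omega, show b*P + (r' - b*P) = r' by omega] at key

end Stmt
end

section
/- Let s, t ≥ 1, n = st, and P = ⌈log₂(4n/s)⌉. Then the number of permutations σ of {1,…,n} such that every run of the binary sequence α(σ_{(s,1)}) has length at most P−1 is at least n!/2. -/
namespace Stmt

theorem count_mono {n k : ℕ} (p : Fin k ↪ Fin n) :
    k.factorial * Fintype.card {π : Equiv.Perm (Fin n) // StrictMono (π ∘ p)} ≤ n.factorial := by
  classical
  have h : Fintype.card (Equiv.Perm (Fin k) × {π : Equiv.Perm (Fin n) // StrictMono (π ∘ p)})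
      ≤ Fintype.card (Equiv.Perm (Fin n)) := by
    apply Fintype.card_le_of_injective
      (fun x => x.2.1 * Equiv.Perm.viaEmbedding x.1 p)
    rintro ⟨a, π, hπ⟩ ⟨b, ρ, hρ⟩ h
    simp only at h
    have h1 : ∀ x, π (p (a x)) = ρ (p (b x)) := by
      intro x
      have := congrArg (fun f : Equiv.Perm (Fin n) => f (p x)) h
      simpa [Equiv.Perm.viaEmbedding_apply] using this
    have h2 : Set.range (π ∘ p) = Set.range (ρ ∘ p) := by
      ext y
      constructor
      · rintro ⟨x, rfl⟩
        exact ⟨b (a.symm x), by simpa using (h1 (a.symm x)).symm⟩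
      · rintro ⟨x, rfl⟩
        exact ⟨a (b.symm x), by simpa using (h1 (b.symm x))⟩
    have h3 : (π ∘ p) = (ρ ∘ p) := (hπ.range_inj hρ).1 h2
    have h4 : a = b := by
      ext x
      have e : (π ∘ p) (a x) = (π ∘ p) (b x) := by
        rw [show (π ∘ p) (a x) = ρ (p (b x)) from h1 x, h3]; rfl
      exact congrArg Fin.val (hπ.injective e)
    subst h4
    have h5 : π = ρ := mul_right_cancel h
    subst h5
    rfl
  simpa [Fintype.card_perm] using h

/-- The positions of the window starting at `i` in the first row. -/
def win (s t P : ℕ) (hs : 1 ≤ s) (i : Fin (t - P)) : Fin (P + 1) ↪ Fin (s * t) where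
  toFun j := ⟨(i + j) * s, by
    have h1 := i.2
    have h2 := j.2
    have h3 : i.1 + j.1 < t := by omega
    rw [mul_comm]
    exact Nat.mul_lt_mul_of_pos_left h3 hs⟩
  inj' := by
    intro a b h
    simp only [Fin.mk.injEq] at h
    have := Nat.eq_of_mul_eq_mul_right hs h
    ext; omega

theorem sig_win (s t P : ℕ) (hs : 1 ≤ s) (i : Fin (t - P)) (π : Equiv.Perm (Fin (s * t)))
    (j : Fin P) :
    sig (row1 s (seqOf (s * t) π)) (i + 1 + j) =
      if π (win s t P hs i j.castSucc) ≤ π (win s t P hs i j.succ) then 1 else 0 := by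
  have key : ∀ a : Fin (P + 1), row1 s (seqOf (s * t) π) (i + 1 + a) =
      (π (win s t P hs i a) : ℕ) + 1 := by
    intro a
    have hlt : (i.1 + a.1) * s < s * t := (win s t P hs i a).2
    have e : i.1 + 1 + a.1 - 1 = i.1 + a.1 := by omega
    simp only [row1, seqOf, e, Nat.add_sub_cancel, hlt, dite_true]
    rfl
  have k1 := key j.castSucc
  have k2 := key j.succ
  simp only [Fin.val_castSucc, Fin.val_succ] at k1 k2
  simp only [sig]
  rw [k1, show i.1 + 1 + j.1 + 1 = i.1 + 1 + (j.1 + 1) by omega, k2]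
  simp

theorem bad_win (s t P : ℕ) (hs : 1 ≤ s) (hP : 2 ≤ P) (π : Equiv.Perm (Fin (s * t)))
    (h : ¬ NoRun (t-1) P (sig (row1 s (seqOf (s * t) π)))) :
    ∃ i : Fin (t - P), StrictMono (π ∘ win s t P hs i) ∨
      StrictMono (π ∘ (Fin.revPerm.toEmbedding.trans (win s t P hs i))) := by
  unfold NoRun at h
  push Not at h
  obtain ⟨i, hi, hit, hc⟩ := h
  have hi' : i - 1 < t - P := by omega
  refine ⟨⟨i - 1, hi'⟩, ?_⟩
  have hsig := sig_win s t P hs ⟨i - 1, hi'⟩ π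
  simp only [Nat.sub_add_cancel hi] at hsig
  have hconst : ∀ m, m < P → sig (row1 s (seqOf (s * t) π)) (i + m)
      = sig (row1 s (seqOf (s * t) π)) i := by
    intro m
    induction m with
    | zero => intro _; rfl
    | succ m ih =>
      intro hm
      rw [← ih (by omega)]
      exact (hc (i + m) (by omega) (by omega)).symm
  by_cases h0 : sig (row1 s (seqOf (s * t) π)) i = 1
  · left
    rw [Fin.strictMono_iff_lt_succ]
    intro j
    have e := hsig j
    rw [hconst j j.2, h0] at e
    have hle : π (win s t P hs ⟨i - 1, hi'⟩ j.castSucc) ≤ π (win s t P hs ⟨i - 1, hi'⟩ j.succ) := by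
      by_contra hh
      simp [hh] at e
    refine lt_of_le_of_ne hle ?_
    intro hh
    have := (win s t P hs ⟨i - 1, hi'⟩).injective (π.injective hh)
    exact (Fin.castSucc_lt_succ (i := j)).ne this
  · right
    have ha : StrictAnti (π ∘ win s t P hs ⟨i - 1, hi'⟩) := by
      rw [Fin.strictAnti_iff_succ_lt]
      intro j
      have e := hsig j
      rw [hconst j j.2] at e
      by_contra hh
      have hh' := not_lt.1 hh
      simp only [Function.comp] at hh'
      rw [if_pos hh'] at e
      exact h0 e
    intro a b hab
    exact ha (Fin.rev_lt_rev.2 hab)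

/-- Lemma: the number of good permutations is at least n!/2. -/
theorem stmt4 (s t n : ℕ) (hs : 1 ≤ s) (ht : 1 ≤ t) (hn : n = s * t)
    (P : ℕ) (hP : P = Nat.clog 2 (4*n/s)) :
    Nat.factorial n ≤ 2 * Nat.card {π : Equiv.Perm (Fin n) //
      NoRun (t-1) P (sig (row1 s (seqOf n π)))} := by
  classical
  subst hn
  have h4 : 4 * (s * t) / s = 4 * t := by
    rw [show 4 * (s * t) = s * (4 * t) by ring]
    exact Nat.mul_div_cancel_left _ hs
  rw [h4] at hP
  have hpow : 4 * t ≤ 2 ^ P := by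
    rw [hP]; exact Nat.le_pow_clog (by norm_num) _
  have hP2 : 2 ≤ P := by
    by_contra hh
    have : 2 ^ P ≤ 2 ^ 1 := Nat.pow_le_pow_right (by norm_num) (by omega)
    omega
  have hfac : 4 * t ≤ (P + 1).factorial := by
    refine hpow.trans ?_
    have := Nat.factorial_mul_pow_le_factorial (m := 1) (n := P)
    simpa [add_comm] using this
  rw [Nat.card_eq_fintype_card, Fintype.card_subtype]
  have htot : _ = Fintype.card (Equiv.Perm (Fin (s * t))) :=
    Finset.card_filter_add_card_filter_not (s := (Finset.univ : Finset (Equiv.Perm (Fin (s * t)))))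
    (fun π => NoRun (t-1) P (sig (row1 s (seqOf (s * t) π))))
  rw [Fintype.card_perm, Fintype.card_fin] at htot
  set G := (Finset.univ.filter (fun π : Equiv.Perm (Fin (s * t)) =>
    NoRun (t-1) P (sig (row1 s (seqOf (s * t) π))))).card
  have hsub : (Finset.univ.filter (fun π : Equiv.Perm (Fin (s * t)) =>
      ¬ NoRun (t-1) P (sig (row1 s (seqOf (s * t) π))))) ⊆
      (Finset.univ : Finset (Fin (t - P))).biUnion (fun i =>
        Finset.univ.filter (fun π : Equiv.Perm (Fin (s * t)) => StrictMono (π ∘ win s t P hs i)) ∪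
        Finset.univ.filter (fun π : Equiv.Perm (Fin (s * t)) =>
          StrictMono (π ∘ (Fin.revPerm.toEmbedding.trans (win s t P hs i))))) := by
    intro π hπ
    rw [Finset.mem_filter] at hπ
    obtain ⟨i, hi⟩ := bad_win s t P hs hP2 π hπ.2
    rw [Finset.mem_biUnion]
    refine ⟨i, Finset.mem_univ _, ?_⟩
    rw [Finset.mem_union, Finset.mem_filter, Finset.mem_filter]
    exact hi.imp (fun h => ⟨Finset.mem_univ _, h⟩) (fun h => ⟨Finset.mem_univ _, h⟩)
  have hX := Finset.card_le_card hsub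
  set X := (Finset.univ.filter (fun π : Equiv.Perm (Fin (s * t)) =>
    ¬ NoRun (t-1) P (sig (row1 s (seqOf (s * t) π))))).card
  have hX2 : (P + 1).factorial * X ≤ (t - P) * (2 * (s * t).factorial) := by
    refine (Nat.mul_le_mul_left _ (hX.trans Finset.card_biUnion_le)).trans ?_
    rw [Finset.mul_sum]
    refine (Finset.sum_le_card_nsmul _ _ (2 * (s * t).factorial) ?_).trans (by simp)
    intro i _
    refine (Nat.mul_le_mul_left _ (Finset.card_union_le _ _)).trans ?_
    have c1 := count_mono (win s t P hs i)
    have c2 := count_mono (Fin.revPerm.toEmbedding.trans (win s t P hs i))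
    rw [Fintype.card_subtype] at c1 c2
    rw [mul_add]
    omega
  have hX3 : 4 * t * X ≤ t * (2 * (s * t).factorial) :=
    (Nat.mul_le_mul_right _ hfac).trans (hX2.trans (Nat.mul_le_mul_right _ (Nat.sub_le _ _)))
  have hX4 : 2 * X ≤ (s * t).factorial := by
    have : t * (4 * X) ≤ t * (2 * (s * t).factorial) := by
      calc t * (4 * X) = 4 * t * X := by ring
        _ ≤ _ := hX3
    have := Nat.le_of_mul_le_mul_left this ht
    omega
  omega

end Stmt
end

section
/- Let s ≥ 1, n = st with t ≥ 2, P ≥ 2, and a ∈ {0,…,t−1}. Let σ and τ be permutations of {1,…,n} such that α(σ_{(s,1)}) and α(τ_{(s,1)}) both lie in VT_a(t−1), and every run of α(σ_{(s,1)}) and every run of α(τ_{(s,1)}) has length at most P−1. Suppose the burst stable deletion of length s at [i,i+s−1] applied to σ produces the same sequence as the burst stable deletion of length s at [i′,i′+s−1] applied to τ. Let k (resp. k′) be the unique element of [i,i+s−1] (resp. [i′,i′+s−1]) congruent to 1 modulo s, and let j = (k−1)/s + 1 and j′ = (k′−1)/s + 1. Then α(σ_{(s,1)}) = α(τ_{(s,1)})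 and |j − j′| ≤ P−1. -/
namespace Stmt

theorem vt_aux (u v : ℕ → ℕ) (d d' : ℕ) (hu : ∀ i, u i ≤ 1) (hd : 1 ≤ d)
    (h1 : ∀ i, 1 ≤ i → i < d → u i = v i)
    (h2 : ∀ i, d ≤ i → i < d' → u (i+1) = v i) (e : ℕ) (hde : d ≤ e) :
    e ≤ d' → ∃ W, W ≤ e - d ∧
      (∑ i ∈ Finset.Icc 1 e, i * u i) + e * v e
        = (∑ i ∈ Finset.Icc 1 e, i * v i) + d * u d + W
      ∧ (W = 0 → ∀ i, d < i → i ≤ e → u i = 0)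
      ∧ (W = e - d → ∀ i, d < i → i ≤ e → u i = 1) := by
  induction e, hde using Nat.le_induction with
  | base =>
    intro _
    refine ⟨0, by omega, ?_, by intros; omega, by intros; omega⟩
    obtain ⟨c, rfl⟩ : ∃ c, d = c + 1 := ⟨d - 1, by omega⟩
    rw [Finset.sum_Icc_succ_top (by omega), Finset.sum_Icc_succ_top (by omega)]
    have : ∑ i ∈ Finset.Icc 1 c, i * u i = ∑ i ∈ Finset.Icc 1 c, i * v i := by
      apply Finset.sum_congr rfl
      intro i hi
      rw [Finset.mem_Icc] at hi
      rw [h1 i (by omega) (by omega)]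
    rw [this]; ring
  | succ e hde ih =>
    intro he
    obtain ⟨W, hW, hs, h0, hf⟩ := ih (by omega)
    have hv := h2 e hde (by omega)
    have hub := hu (e+1)
    refine ⟨W + u (e+1), by omega, ?_, ?_, ?_⟩
    · rw [Finset.sum_Icc_succ_top (by omega), Finset.sum_Icc_succ_top (by omega)]
      rw [← hv] at hs
      linarith
    · intro h i hi hie
      rcases Nat.lt_or_ge e i with h' | h'
      · obtain rfl : i = e + 1 := by omega
        omega
      · exact h0 (by omega) i hi h'
    · intro h i hi hie
      rcases Nat.lt_or_ge e i with h' | h'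
      · obtain rfl : i = e + 1 := by omega
        omega
      · exact hf (by omega) i hi h'

theorem vt_le (m : ℕ) (u v : ℕ → ℕ) (d d' : ℕ) (hu : ∀ i, u i ≤ 1) (hv : ∀ i, v i ≤ 1)
    (hd : 1 ≤ d) (hdd : d ≤ d') (hd' : d' ≤ m)
    (h : ∀ i, 1 ≤ i → i + 1 ≤ m →
      (if i < d then u i else u (i+1)) = (if i < d' then v i else v (i+1)))
    (hvt : (∑ i ∈ Finset.Icc 1 m, i * u i) ≡ (∑ i ∈ Finset.Icc 1 m, i * v i) [MOD m+1]) :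
    ∀ i, 1 ≤ i → i ≤ m → u i = v i := by
  have h1 : ∀ i, 1 ≤ i → i < d → u i = v i := by
    intro i hi hid
    have := h i hi (by omega)
    rwa [if_pos hid, if_pos (by omega)] at this
  have h2 : ∀ i, d ≤ i → i < d' → u (i+1) = v i := by
    intro i hi hid
    have := h i (by omega) (by omega)
    rwa [if_neg (by omega), if_pos (by omega)] at this
  have h3 : ∀ i, d' < i → i ≤ m → u i = v i := by
    intro i hi hid
    have := h (i-1) (by omega) (by omega)
    rwa [if_neg (by omega), if_neg (by omega), Nat.sub_add_cancel (by omega)] at this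
  obtain ⟨W, hW, hs, h0, hf⟩ := vt_aux u v d d' hu hd h1 h2 d' hdd le_rfl
  have key : ∀ e, d' ≤ e → e ≤ m → (∑ i ∈ Finset.Icc 1 e, i * u i) + d' * v d'
        = (∑ i ∈ Finset.Icc 1 e, i * v i) + d * u d + W := by
    intro e he
    induction e, he using Nat.le_induction with
    | base => intro _; exact hs
    | succ e he ih =>
      intro hm
      have := ih (by omega)
      rw [Finset.sum_Icc_succ_top (by omega), Finset.sum_Icc_succ_top (by omega),
        h3 (e+1) (by omega) hm]
      linarith
  have hk := key m hd' le_rfl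
  have hdvd := (Nat.modEq_iff_dvd.mp hvt)
  obtain ⟨q, hq⟩ := hdvd
  have hud := hu d
  have hvd := hv d'
  have hall : ∀ c, u d = c → v d' = c → (∀ i, d < i → i ≤ d' → u i = c) →
      ∀ i, 1 ≤ i → i ≤ m → u i = v i := by
    intro c hc hc' hcc i hi him
    rcases Nat.lt_or_ge i d with h' | h'
    · exact h1 i hi h'
    rcases Nat.lt_or_ge d' i with h'' | h''
    · exact h3 i h'' him
    have e1 : u i = c := by
      rcases Nat.lt_or_ge d i with h4 | h4
      · exact hcc i h4 h''
      · obtain rfl : i = d := by omega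
        exact hc
    rcases Nat.lt_or_ge i d' with h4 | h4
    · rw [e1, ← h2 i h' h4, hcc (i+1) (by omega) (by omega)]
    · obtain rfl : i = d' := by omega
      rw [e1, hc']
  have hsmall : ∀ z : ℤ, z = ((m+1 : ℕ) : ℤ) * q → z ≤ m → -(m:ℤ) ≤ z → z = 0 := by
    intro z hz h4 h5
    apply Int.eq_zero_of_abs_lt_dvd (m := ((m+1 : ℕ) : ℤ)) ⟨q, hz⟩
    rw [abs_lt]; push_cast; constructor <;> linarith
  rcases (by omega : u d = 0 ∨ u d = 1) with a | a <;>
  rcases (by omega : v d' = 0 ∨ v d' = 1) with b | b <;>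
  rw [a, b] at hk <;> have := hsmall _ hq (by omega) (by omega)
  · exact hall 0 a b (h0 (by omega))
  · omega
  · omega
  · exact hall 1 a b (hf (by omega))

theorem vt_all (m : ℕ) (u v : ℕ → ℕ) (d d' : ℕ) (hu : ∀ i, u i ≤ 1) (hv : ∀ i, v i ≤ 1)
    (hd : 1 ≤ d) (hdm : d ≤ m) (hd1 : 1 ≤ d') (hd' : d' ≤ m)
    (h : ∀ i, 1 ≤ i → i + 1 ≤ m →
      (if i < d then u i else u (i+1)) = (if i < d' then v i else v (i+1)))
    (hvt : (∑ i ∈ Finset.Icc 1 m, i * u i) ≡ (∑ i ∈ Finset.Icc 1 m, i * v i) [MOD m+1]) :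
    ∀ i, 1 ≤ i → i ≤ m → u i = v i := by
  rcases Nat.le_total d d' with h' | h'
  · exact vt_le m u v d d' hu hv hd h' hd' h hvt
  · intro i h1 h2
    exact (vt_le m v u d' d hv hu hd1 h' hdm (fun i a b => (h i a b).symm) hvt.symm i h1 h2).symm

theorem sig_le_one (x : ℕ → ℕ) (i : ℕ) : sig x i ≤ 1 := by
  unfold sig; split_ifs <;> omega

theorem sig_del (t : ℕ) (ht : 2 ≤ t) (x : ℕ → ℕ) (j : ℕ) (hj : 1 ≤ j) (hjt : j ≤ t) :
    ∃ d, 1 ≤ d ∧ d ≤ t - 1 ∧ ∀ m, 1 ≤ m → m + 1 ≤ t - 1 →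
      (if m < d then sig x m else sig x (m+1))
        = sig (fun m => if m < j then x m else x (m+1)) m := by
  have hlow : ∀ m, m + 1 < j → sig (fun m => if m < j then x m else x (m+1)) m = sig x m := by
    intro m hm
    simp only [sig, if_pos hm, if_pos (show m < j by omega)]
  have hhigh : ∀ m, j ≤ m →
      sig (fun m => if m < j then x m else x (m+1)) m = sig x (m+1) := by
    intro m hm
    simp only [sig, if_neg (show ¬ m < j by omega), if_neg (show ¬ m + 1 < j by omega)]
  have hmid : ∀ m, m + 1 = j →
      sig (fun m => if m < j then x m else x (m+1)) m = sig x m ∨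
      sig (fun m => if m < j then x m else x (m+1)) m = sig x (m+1) := by
    intro m hm
    simp only [sig, if_pos (show m < j by omega), if_neg (show ¬ m + 1 < j by omega)]
    split_ifs <;> omega
  by_cases c1 : j = t
  · refine ⟨t-1, by omega, le_rfl, fun m h1 h2 => ?_⟩
    rw [if_pos (by omega), hlow m (by omega)]
  by_cases c2 : j = 1
  · refine ⟨1, by omega, by omega, fun m h1 h2 => ?_⟩
    rw [if_neg (by omega), hhigh m (by omega)]
  rcases hmid (j-1) (by omega) with h | h
  · refine ⟨j, by omega, by omega, fun m h1 h2 => ?_⟩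
    rcases Nat.lt_trichotomy (m+1) j with h' | h' | h'
    · rw [if_pos (by omega), hlow m h']
    · obtain rfl : m = j - 1 := by omega
      rw [if_pos (by omega), h]
    · rw [if_neg (by omega), hhigh m (by omega)]
  · refine ⟨j-1, by omega, by omega, fun m h1 h2 => ?_⟩
    rcases Nat.lt_trichotomy (m+1) j with h' | h' | h'
    · rw [if_pos (by omega), hlow m h']
    · obtain rfl : m = j - 1 := by omega
      rw [if_neg (by omega), h]
    · rw [if_neg (by omega), hhigh m (by omega)]

theorem run_bound (t P : ℕ) (hP : 2 ≤ P) (x y : ℕ → ℕ) (j j' : ℕ)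
    (hj : 1 ≤ j) (hjt : j' ≤ t)
    (h : ∀ m, 1 ≤ m → m + 1 ≤ t →
      (if m < j then x m else x (m+1)) = (if m < j' then y m else y (m+1)))
    (hs : ∀ i, 1 ≤ i → i ≤ t - 1 → sig x i = sig y i)
    (hr : NoRun (t-1) P (sig x)) : j' ≤ j + (P - 1) := by
  by_contra hc
  obtain ⟨q, h1, h2, h3⟩ := hr j hj (by omega)
  apply h3
  have e1 := h q (by omega) (by omega)
  have e2 := h (q+1) (by omega) (by omega)
  rw [if_neg (by omega), if_pos (by omega)] at e1 e2
  rw [hs q (by omega) (by omega)]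
  simp only [sig, e1, e2]

theorem col_spec (s t n : ℕ) (hs : 1 ≤ s) (hn : n = s * t) (i k j : ℕ) (hi : 1 ≤ i)
    (hi2 : i + s - 1 ≤ n) (hk : i ≤ k ∧ k ≤ i + s - 1 ∧ k % s = 1 % s)
    (hj : j = (k-1)/s + 1) :
    1 ≤ j ∧ j ≤ t ∧ ∀ m, 1 ≤ m → ((m-1)*s+1 < i ↔ m < j) := by
  obtain ⟨ha, hb, hc⟩ := hk
  have hdv : s ∣ k - 1 := (Nat.modEq_iff_dvd' (by omega)).mp (show 1 ≡ k [MOD s] from hc.symm)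
  obtain ⟨q, hq⟩ := hdv
  rw [hq, Nat.mul_div_cancel_left _ (by omega)] at hj
  subst hj
  refine ⟨by omega, ?_, ?_⟩
  · have : s * q < s * t := by omega
    have := Nat.lt_of_mul_lt_mul_left this
    omega
  · intro m hm
    obtain ⟨c, rfl⟩ : ∃ c, m = c + 1 := ⟨m - 1, by omega⟩
    simp only [Nat.add_sub_cancel]
    constructor
    · intro h
      have : s * c < s * q := by rw [mul_comm s c]; omega
      have := Nat.lt_of_mul_lt_mul_left this
      omega
    · intro h
      have : s * (c + 1) ≤ s * q := Nat.mul_le_mul_left _ (by omega)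
      rw [mul_add, mul_comm s c] at this
      omega

/-- Lemma: for good permutations whose first-row signature lies in a VT code,
the signatures coincide and the erroneous column is located within an interval of length P. -/
theorem stmt5 (s t n : ℕ) (hs : 1 ≤ s) (ht : 2 ≤ t) (hn : n = s * t)
    (P : ℕ) (hP : 2 ≤ P) (a : ℕ) (ha : a < t)
    (σ τ : ℕ → ℕ)
    (hσperm : Set.BijOn σ (Set.Icc 1 n) (Set.Icc 1 n))
    (hτperm : Set.BijOn τ (Set.Icc 1 n) (Set.Icc 1 n))
    (hVTσ : (∑ i ∈ Finset.Icc 1 (t-1), i * sig (row1 s σ) i) ≡ a [MOD t])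
    (hVTτ : (∑ i ∈ Finset.Icc 1 (t-1), i * sig (row1 s τ) i) ≡ a [MOD t])
    (hrunσ : NoRun (t-1) P (sig (row1 s σ)))
    (hrunτ : NoRun (t-1) P (sig (row1 s τ)))
    (i i' : ℕ) (hi : 1 ≤ i) (hi2 : i + s - 1 ≤ n)
    (hi' : 1 ≤ i') (hi2' : i' + s - 1 ≤ n)
    (hdel : BurstDelEq n s σ τ i i')
    (k k' j j' : ℕ)
    (hk : i ≤ k ∧ k ≤ i + s - 1 ∧ k % s = 1 % s)
    (hk' : i' ≤ k' ∧ k' ≤ i' + s - 1 ∧ k' % s = 1 % s)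
    (hj : j = (k-1)/s + 1) (hj' : j' = (k'-1)/s + 1) :
    (∀ i ∈ Finset.Icc 1 (t-1), sig (row1 s σ) i = sig (row1 s τ) i)
    ∧ |(j : ℤ) - (j' : ℤ)| ≤ (P : ℤ) - 1 := by
  obtain ⟨j1, j2, j3⟩ := col_spec s t n hs hn i k j hi hi2 hk hj
  obtain ⟨j1', j2', j3'⟩ := col_spec s t n hs hn i' k' j' hi' hi2' hk' hj'
  have hrow : ∀ m, 1 ≤ m → m + 1 ≤ t →
      (if m < j then row1 s σ m else row1 s σ (m+1))
        = (if m < j' then row1 s τ m else row1 s τ (m+1)) := by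
    intro m h1 h2
    have hle : (m-1)*s+1 + s ≤ n := by
      obtain ⟨c, rfl⟩ : ∃ c, m = c + 1 := ⟨m - 1, by omega⟩
      have : s * (c + 1 + 1) ≤ s * t := Nat.mul_le_mul_left _ h2
      rw [← hn, mul_add, mul_add, mul_comm s c] at this
      simp only [Nat.add_sub_cancel]
      omega
    have := hdel ((m-1)*s+1) (by rw [Finset.mem_Icc]; omega)
    simp only [j3 m h1, j3' m h1] at this
    have he : (m + 1 - 1) * s + 1 = (m-1)*s+1+s := by
      obtain ⟨c, rfl⟩ : ∃ c, m = c + 1 := ⟨m - 1, by omega⟩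
      simp only [Nat.add_sub_cancel]
      ring
    simp only [row1, he]
    exact this
  obtain ⟨d, d1, d2, d3⟩ := sig_del t ht (row1 s σ) j j1 j2
  obtain ⟨d', d1', d2', d3'⟩ := sig_del t ht (row1 s τ) j' j1' j2'
  have hsig : ∀ i, 1 ≤ i → i ≤ t - 1 → sig (row1 s σ) i = sig (row1 s τ) i := by
    refine vt_all (t-1) _ _ d d' (sig_le_one _) (sig_le_one _) d1 d2 d1' d2' ?_ ?_
    · intro m h1 h2
      rw [d3 m h1 h2, d3' m h1 h2]
      unfold sig
      simp only [hrow m h1 (by omega), hrow (m+1) (by omega) (by omega)]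
    · rw [Nat.sub_add_cancel (by omega)]
      exact hVTσ.trans hVTτ.symm
  refine ⟨fun i h => hsig i (Finset.mem_Icc.mp h).1 (Finset.mem_Icc.mp h).2, ?_⟩
  have b1 := run_bound t P hP _ _ j j' j1 j2' hrow hsig hrunσ
  have b2 := run_bound t P hP _ _ j' j j1' j2 (fun m a b => (hrow m a b).symm)
    (fun m a b => (hsig m a b).symm) hrunτ
  rw [abs_le]
  omega

end Stmt
end

section
/- Let s ≥ 1 and let n = st with t even. Let σ and τ be permutations of {1,…,n} that both lie in C^recover_{d1,d2}(n,s) for the same d1, d2 ∈ {0,…,(2s)!−1}. If there exists j ∈ {1,…,t−1} such that σ^{(s,j″)} = τ^{(s,j″)} for every column index j″ ∈ {1,…,t} \ {j, j+1}, then σ = τ. -/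
namespace Stmt

theorem permRank_congr (u v : ℕ → ℕ) (m : ℕ) (h : ∀ l, 1 ≤ l → l ≤ m → u l = v l) :
    permRank u m = permRank v m := by
  have : (List.range' 1 m).map (fun i => betaProj u m i)
      = (List.range' 1 m).map (fun i => betaProj v m i) := by
    apply List.map_congr_left
    intro i hi
    rw [List.mem_range'_1] at hi
    unfold betaProj
    congr 2
    · apply Finset.filter_congr
      intro k hk
      rw [Finset.mem_Icc] at hk
      rw [h k hk.1 hk.2, h i hi.1 (by omega)]
    · apply Finset.filter_congr
      intro k hk
      rw [Finset.mem_Icc] at hk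
      rw [h k hk.1 (by omega), h i hi.1 (by omega)]
  unfold permRank
  rw [this]

theorem beta_eq (u : ℕ → ℕ) (m i : ℕ) (hu : Set.InjOn u (Set.Icc 1 m)) (h1 : 1 ≤ i)
    (h2 : i ≤ m) :
    betaProj u m i = (((Finset.Icc 1 m).image u).filter (· < u i)).card + 1 := by
  unfold betaProj
  congr 1
  · rw [Finset.filter_image, Finset.card_image_of_injOn]
    intro a ha b hb hab
    simp only [Finset.coe_filter, Finset.mem_Icc, Set.mem_ofPred_eq] at ha hb
    exact hu ha.1 hb.1 hab
  · rw [Finset.card_eq_one]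
    refine ⟨i, ?_⟩
    ext k
    simp only [Finset.mem_filter, Finset.mem_Icc, Finset.mem_singleton]
    constructor
    · rintro ⟨hk, e⟩
      exact hu ⟨hk.1, by omega⟩ ⟨h1, h2⟩ e
    · rintro rfl
      exact ⟨⟨h1, le_refl _⟩, rfl⟩

theorem rank_lt (S : Finset ℕ) (x y : ℕ) (hx : x ∈ S) (h : x < y) :
    (S.filter (· < x)).card < (S.filter (· < y)).card := by
  apply Finset.card_lt_card
  rw [Finset.ssubset_iff_of_subset]
  · exact ⟨x, by simp [hx, h], by simp⟩
  · intro z hz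
    simp only [Finset.mem_filter] at hz ⊢
    exact ⟨hz.1, by omega⟩

theorem rank_inj (S : Finset ℕ) (x y : ℕ) (hx : x ∈ S) (hy : y ∈ S)
    (h : (S.filter (· < x)).card = (S.filter (· < y)).card) : x = y := by
  rcases lt_trichotomy x y with h' | h' | h'
  · have := rank_lt S x y hx h'
    omega
  · exact h'
  · have := rank_lt S y x hy h'
    omega

theorem beta_perm (u : ℕ → ℕ) (m : ℕ) (hu : Set.InjOn u (Set.Icc 1 m)) :
    ((List.range' 1 m).map (fun i => betaProj u m i)).Perm (List.range' 1 m) := by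
  have hmem : ∀ i, 1 ≤ i → i ≤ m → u i ∈ (Finset.Icc 1 m).image u := by
    intro i h1 h2
    exact Finset.mem_image_of_mem _ (Finset.mem_Icc.2 ⟨h1, h2⟩)
  have hnd : ((List.range' 1 m).map (fun i => betaProj u m i)).Nodup := by
    apply List.Nodup.map_on
    · intro x hx y hy hxy
      rw [List.mem_range'_1] at hx hy
      rw [beta_eq u m x hu (by omega) (by omega), beta_eq u m y hu (by omega) (by omega)] at hxy
      exact hu ⟨by omega, by omega⟩ ⟨by omega, by omega⟩
        (rank_inj _ _ _ (hmem x (by omega) (by omega)) (hmem y (by omega) (by omega))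
          (by omega))
    · exact List.nodup_range'
  have hsub : ((List.range' 1 m).map (fun i => betaProj u m i)) ⊆ (List.range' 1 m) := by
    intro b hb
    rw [List.mem_map] at hb
    obtain ⟨i, hi, rfl⟩ := hb
    rw [List.mem_range'_1] at hi ⊢
    rw [beta_eq u m i hu (by omega) (by omega)]
    have h1 : (((Finset.Icc 1 m).image u).filter (· < u i)).card
        < ((Finset.Icc 1 m).image u).card := by
      apply Finset.card_lt_card
      rw [Finset.ssubset_iff_of_subset (Finset.filter_subset _ _)]
      exact ⟨u i, hmem i (by omega) (by omega), by simp⟩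
    have h2 : ((Finset.Icc 1 m).image u).card ≤ (Finset.Icc 1 m).card := Finset.card_image_le
    rw [Nat.card_Icc] at h2
    omega
  exact (List.subperm_of_subset hnd hsub).perm_of_length_le (by simp)

theorem lexcount_lt (L : List (List ℕ)) (a b : List ℕ) (ha : a ∈ L) (hab : a < b) :
    (L.filter (fun l => decide (List.Lex (· < ·) l a))).length
      < (L.filter (fun l => decide (List.Lex (· < ·) l b))).length := by
  have hsub : (L.filter (fun l => decide (List.Lex (· < ·) l a))).Sublist
      (L.filter (fun l => decide (List.Lex (· < ·) l b))) := by
    apply List.monotone_filter_right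
    intro l hl
    simp only [decide_eq_true_eq] at hl ⊢
    exact lt_trans (show l < a from hl) hab
  apply lt_of_le_of_ne hsub.length_le
  intro he
  have e := hsub.eq_of_length he
  have : a ∈ L.filter (fun l => decide (List.Lex (· < ·) l b)) := by
    rw [List.mem_filter]
    exact ⟨ha, by simpa using hab⟩
  rw [← e, List.mem_filter] at this
  have h2 : a < a := by simpa using this.2
  exact lt_irrefl _ h2

theorem lexcount_lt_length (L : List (List ℕ)) (a : List ℕ) (ha : a ∈ L) :
    (L.filter (fun l => decide (List.Lex (· < ·) l a))).length < L.length := by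
  apply lt_of_le_of_ne (List.length_filter_le _ _)
  intro he
  rw [List.length_filter_eq_length_iff] at he
  have h2 : a < a := by simpa using he a ha
  exact lt_irrefl _ h2

theorem rank_determines (u v : ℕ → ℕ) (m : ℕ) (hu : Set.InjOn u (Set.Icc 1 m))
    (hv : Set.InjOn v (Set.Icc 1 m))
    (him : (Finset.Icc 1 m).image u = (Finset.Icc 1 m).image v)
    (hr : permRank u m ≡ permRank v m [MOD Nat.factorial m]) :
    ∀ i, 1 ≤ i → i ≤ m → u i = v i := by
  have hlist : (List.range' 1 m).map (fun i => betaProj u m i)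
      = (List.range' 1 m).map (fun i => betaProj v m i) := by
    have ma := List.mem_permutations.2 (beta_perm u m hu)
    have mb := List.mem_permutations.2 (beta_perm v m hv)
    unfold permRank at hr
    have hr := Nat.ModEq.add_left_cancel' 1 hr
    have la := lexcount_lt_length _ _ ma
    have lb := lexcount_lt_length _ _ mb
    have hlen : (List.range' 1 m).permutations.length = Nat.factorial m := by
      simp [List.length_permutations]
    rw [hlen] at la lb
    have heq := Nat.ModEq.eq_of_lt_of_lt hr la lb
    rcases lt_trichotomy ((List.range' 1 m).map (fun i => betaProj u m i))
      ((List.range' 1 m).map (fun i => betaProj v m i)) with h | h | h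
    · exact absurd heq (lexcount_lt _ _ _ ma h).ne
    · exact h
    · exact absurd heq.symm (lexcount_lt _ _ _ mb h).ne
  intro i h1 h2
  have hb : betaProj u m i = betaProj v m i :=
    List.map_inj_left.1 hlist i (by rw [List.mem_range'_1]; omega)
  rw [beta_eq u m i hu h1 h2, beta_eq v m i hv h1 h2, ← him] at hb
  apply rank_inj ((Finset.Icc 1 m).image u)
  · exact Finset.mem_image_of_mem _ (Finset.mem_Icc.2 ⟨h1, h2⟩)
  · rw [him]
    exact Finset.mem_image_of_mem _ (Finset.mem_Icc.2 ⟨h1, h2⟩)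
  · omega

theorem sum_cancel (M N i0 : ℕ) (f g : ℕ → ℕ) (h0 : 1 ≤ i0) (h1 : i0 ≤ N)
    (hfg : ∀ i, 1 ≤ i → i ≤ N → i ≠ i0 → f i = g i)
    (h : ∑ i ∈ Finset.Icc 1 N, f i ≡ ∑ i ∈ Finset.Icc 1 N, g i [MOD M]) :
    f i0 ≡ g i0 [MOD M] := by
  have hm : i0 ∈ Finset.Icc 1 N := Finset.mem_Icc.2 ⟨h0, h1⟩
  rw [← Finset.add_sum_erase _ f hm, ← Finset.add_sum_erase _ g hm] at h
  have : ∑ i ∈ (Finset.Icc 1 N).erase i0, f i = ∑ i ∈ (Finset.Icc 1 N).erase i0, g i := by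
    apply Finset.sum_congr rfl
    intro i hi
    rw [Finset.mem_erase, Finset.mem_Icc] at hi
    exact hfg i hi.2.1 hi.2.2 hi.1
  rw [this] at h
  exact Nat.ModEq.add_right_cancel' _ h

theorem pair_agree (s t : ℕ) (σ τ : ℕ → ℕ) (j k : ℕ) (ht : t % 2 = 0)
    (hj1 : 1 ≤ j) (hk1 : 1 ≤ k) (hkt : k ≤ t) (hkj : k ≠ j)
    (hpar : k % 2 = j % 2)
    (heq : ∀ j'', 1 ≤ j'' → j'' ≤ t → j'' ≠ j → j'' ≠ j + 1 →
      ∀ l, 1 ≤ l → l ≤ s → σ ((j''-1)*s + l) = τ ((j''-1)*s + l)) :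
    ∀ l, 1 ≤ l → l ≤ 2 * s → pairBlk σ s t k l = pairBlk τ s t k l := by
  intro l hl1 hl2
  unfold pairBlk blockAt
  split_ifs with hl
  · rw [Nat.mod_eq_of_lt (by omega : k - 1 < t)]
    exact heq k hk1 hkt hkj (by omega) l hl1 hl
  · rw [Nat.add_sub_cancel]
    rcases Nat.lt_or_ge k t with hlt | hge
    · rw [Nat.mod_eq_of_lt hlt]
      exact heq (k+1) (by omega) (by omega) (by omega) (by omega) (l - s) (by omega) (by omega)
    · have : k = t := by omega
      subst this
      rw [Nat.mod_self]
      exact heq 1 (by omega) (by omega) (by omega) (by omega) (l - s) (by omega) (by omega)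

theorem pair_val (s t : ℕ) (σ : ℕ → ℕ) (j l : ℕ) (hj1 : 1 ≤ j) (hjt : j < t) :
    pairBlk σ s t j l = σ ((j-1)*s + l) := by
  unfold pairBlk blockAt
  rw [Nat.add_sub_cancel, Nat.mod_eq_of_lt hjt, Nat.mod_eq_of_lt (by omega : j - 1 < t)]
  split_ifs with hl
  · rfl
  · congr 1
    obtain ⟨j, rfl⟩ := Nat.exists_eq_add_of_le' hj1
    rw [Nat.add_sub_cancel, Nat.add_mul]
    omega

theorem off_agree (s t : ℕ) (hs : 1 ≤ s) (σ τ : ℕ → ℕ) (j : ℕ) (hj1 : 1 ≤ j)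
    (heq : ∀ j'', 1 ≤ j'' → j'' ≤ t → j'' ≠ j → j'' ≠ j + 1 →
      ∀ l, 1 ≤ l → l ≤ s → σ ((j''-1)*s + l) = τ ((j''-1)*s + l))
    (i : ℕ) (hi1 : 1 ≤ i) (hi2 : i ≤ s * t)
    (hoff : ¬ ∃ l, 1 ≤ l ∧ l ≤ 2 * s ∧ i = (j-1)*s + l) : σ i = τ i := by
  obtain ⟨j, rfl⟩ := Nat.exists_eq_add_of_le' hj1
  rw [Nat.add_sub_cancel] at hoff
  have hd := Nat.div_add_mod (i-1) s
  have hm := Nat.mod_lt (i-1) (by omega : 0 < s)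
  have hq : (i-1)/s < t := by
    rw [Nat.div_lt_iff_lt_mul (by omega), mul_comm]
    omega
  generalize (i-1)/s = q at *
  generalize (i-1)%s = r at *
  have hi : i = (q + 1 - 1) * s + (r+1) := by
    rw [Nat.add_sub_cancel, mul_comm]
    omega
  rw [hi]
  refine heq (q+1) (by omega) (by omega) ?_ ?_ (r+1) (by omega) (by omega)
  · intro e
    have : q = j := by omega
    subst this
    exact hoff ⟨r+1, by omega, by omega, by simpa using hi⟩
  · intro e
    have : q = j + 1 := by omega
    subst this
    refine hoff ⟨s + (r+1), by omega, by omega, ?_⟩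
    rw [hi, Nat.add_sub_cancel, Nat.add_mul]
    omega

theorem image_sub (s t j : ℕ) (σ τ : ℕ → ℕ) (hj1 : 1 ≤ j) (hjt : j < t)
    (hσperm : Set.BijOn σ (Set.Icc 1 (s*t)) (Set.Icc 1 (s*t)))
    (hτperm : Set.BijOn τ (Set.Icc 1 (s*t)) (Set.Icc 1 (s*t)))
    (hin : ∀ l, 1 ≤ l → l ≤ 2 * s → (j-1)*s + l ≤ s * t)
    (hoff : ∀ i, 1 ≤ i → i ≤ s * t → (¬ ∃ l, 1 ≤ l ∧ l ≤ 2 * s ∧ i = (j-1)*s + l) →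
      σ i = τ i) :
    (Finset.Icc 1 (2*s)).image (pairBlk σ s t j)
      ⊆ (Finset.Icc 1 (2*s)).image (pairBlk τ s t j) := by
  intro x hx
  rw [Finset.mem_image] at hx ⊢
  obtain ⟨l, hl, rfl⟩ := hx
  rw [Finset.mem_Icc] at hl
  rw [pair_val s t σ j l hj1 hjt]
  have hA : (j-1)*s + l ∈ Set.Icc 1 (s*t) := ⟨by omega, hin l hl.1 hl.2⟩
  obtain ⟨a, ha, hax⟩ := hτperm.surjOn (hσperm.mapsTo hA)
  by_cases hex : ∃ l, 1 ≤ l ∧ l ≤ 2 * s ∧ a = (j-1)*s + l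
  · obtain ⟨l', h1, h2, rfl⟩ := hex
    exact ⟨l', Finset.mem_Icc.2 ⟨h1, h2⟩, by rw [pair_val s t τ j l' hj1 hjt]; exact hax⟩
  · have := hoff a ha.1 ha.2 hex
    rw [← this] at hax
    have := hσperm.injOn ha hA hax
    exact absurd ⟨l, hl.1, hl.2, this⟩ hex

/-- Lemma: two adjacent erroneous columns are corrected by membership
in C^recover. -/
theorem stmt6 (s t n : ℕ) (hs : 1 ≤ s) (ht : Even t) (ht1 : 1 ≤ t) (hn : n = s * t)
    (d1 d2 : ℕ) (hd1 : d1 < Nat.factorial (2*s)) (hd2 : d2 < Nat.factorial (2*s))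
    (σ τ : ℕ → ℕ)
    (hσperm : Set.BijOn σ (Set.Icc 1 n) (Set.Icc 1 n))
    (hτperm : Set.BijOn τ (Set.Icc 1 n) (Set.Icc 1 n))
    (hσ : CRecover n s d1 d2 σ) (hτ : CRecover n s d1 d2 τ)
    (j : ℕ) (hj1 : 1 ≤ j) (hj2 : j ≤ t - 1)
    (heq : ∀ j'', 1 ≤ j'' → j'' ≤ t → j'' ≠ j → j'' ≠ j + 1 →
      ∀ l, 1 ≤ l → l ≤ s → σ ((j''-1)*s + l) = τ ((j''-1)*s + l)) :
    ∀ i ∈ Finset.Icc 1 n, σ i = τ i := by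
  have hjt : j < t := by omega
  have htp : t % 2 = 0 := Nat.even_iff.1 ht
  subst hn
  have hn1 : s * t / s = t := Nat.mul_div_cancel_left t (by omega)
  have hn2 : s * t / (2 * s) = t / 2 := by
    rw [← Nat.div_div_eq_div_mul, Nat.div_right_comm, hn1]
  have hin : ∀ l, 1 ≤ l → l ≤ 2 * s → (j-1)*s + l ≤ s * t := by
    intro l h1 h2
    have h3 : (j - 1 + 2) * s ≤ t * s := Nat.mul_le_mul_right s (by omega)
    rw [Nat.add_mul, mul_comm t s] at h3
    omega
  have hoff := off_agree s t hs σ τ j hj1 heq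
  have him : (Finset.Icc 1 (2*s)).image (pairBlk σ s t j)
      = (Finset.Icc 1 (2*s)).image (pairBlk τ s t j) := by
    apply Finset.Subset.antisymm
    · exact image_sub s t j σ τ hj1 hjt hσperm hτperm hin hoff
    · exact image_sub s t j τ σ hj1 hjt hτperm hσperm hin
        (fun i h1 h2 h3 => (hoff i h1 h2 h3).symm)
  have hinj : ∀ ρ : ℕ → ℕ, Set.BijOn ρ (Set.Icc 1 (s*t)) (Set.Icc 1 (s*t)) →
      Set.InjOn (pairBlk ρ s t j) (Set.Icc 1 (2*s)) := by
    intro ρ hρ a ha b hb hab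
    rw [pair_val s t ρ j a hj1 hjt, pair_val s t ρ j b hj1 hjt] at hab
    have := hρ.injOn (x₁ := (j-1)*s+a) (x₂ := (j-1)*s+b) ⟨by have := ha.1; omega, hin a ha.1 ha.2⟩
      ⟨by have := hb.1; omega, hin b hb.1 hb.2⟩ hab
    omega
  have hr : permRank (pairBlk σ s t j) (2*s) ≡ permRank (pairBlk τ s t j) (2*s)
      [MOD Nat.factorial (2*s)] := by
    obtain ⟨a1, a2⟩ := hσ
    obtain ⟨b1, b2⟩ := hτ
    rw [hn1, hn2] at a1 a2 b1 b2
    rcases Nat.mod_two_eq_zero_or_one j with hp | hp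
    · have h := sum_cancel _ _ (j/2) _ _ (by omega) (by omega) ?_ (a2.trans b2.symm)
      · rwa [show 2 * (j/2) = j by omega] at h
      · intro i h1 h2 h3
        exact permRank_congr _ _ _ (pair_agree s t σ τ j (2*i) htp hj1 (by omega) (by omega)
          (by omega) (by omega) heq)
    · have h := sum_cancel _ _ ((j+1)/2) _ _ (by omega) (by omega) ?_ (a1.trans b1.symm)
      · rwa [show 2 * ((j+1)/2) - 1 = j by omega] at h
      · intro i h1 h2 h3
        exact permRank_congr _ _ _ (pair_agree s t σ τ j (2*i-1) htp hj1 (by omega) (by omega)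
          (by omega) (by omega) heq)
  have hfin := rank_determines _ _ _ (hinj σ hσperm) (hinj τ hτperm) him hr
  intro i hi
  rw [Finset.mem_Icc] at hi
  by_cases hex : ∃ l, 1 ≤ l ∧ l ≤ 2 * s ∧ i = (j-1)*s + l
  · obtain ⟨l, h1, h2, rfl⟩ := hex
    have := hfin l h1 h2
    rwa [pair_val s t σ j l hj1 hjt, pair_val s t τ j l hj1 hjt] at this
  · exact hoff i hi.1 hi.2 hex

end Stmt
end

section
/- Let s ≥ 1, n = st with t even, P = ⌈log₂(4n/s)⌉, and assume 2Ps divides n. Then there exist a ∈ {0,…,t−1}, c1,c2 ∈ {0,…,2Ps−1}, and d1,d2 ∈ {0,…,(2s)!−1} such that the code C_s^1(n;a;c1,c2;d1,d2) has size at least n! / (2 · (n/s) · (2Ps)² · ((2s)!)²). -/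
namespace Stmt

theorem card_mul_fact_le {n m : ℕ} (e : Fin m ↪ Fin n) (S : Finset (Equiv.Perm (Fin n)))
    (h : ∀ π ∈ S, ∀ ρ : Equiv.Perm (Fin m), π * ρ.viaFintypeEmbedding e ∈ S → ρ = 1) :
    S.card * m.factorial ≤ n.factorial := by
  classical
  have hmul : ∀ a b : Equiv.Perm (Fin m), (a * b).viaFintypeEmbedding e =
      a.viaFintypeEmbedding e * b.viaFintypeEmbedding e := fun a b =>
    (Equiv.Perm.extendDomain_mul _ _ _).symm
  have hone : (1 : Equiv.Perm (Fin m)).viaFintypeEmbedding e = 1 :=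
    Equiv.Perm.extendDomain_one _
  have hc : (S ×ˢ (Finset.univ : Finset (Equiv.Perm (Fin m)))).card ≤
      (Finset.univ : Finset (Equiv.Perm (Fin n))).card := by
    apply Finset.card_le_card_of_injOn (fun p => p.1 * p.2.viaFintypeEmbedding e)
    · intro p _; simp
    · rintro ⟨π, τ⟩ h1 ⟨π', τ'⟩ h2 heq
      simp only [Finset.coe_product, Set.mem_prod, Finset.mem_coe] at h1 h2
      have heq : π * τ.viaFintypeEmbedding e = π' * τ'.viaFintypeEmbedding e := heq
      have h3 : π * (τ * τ'⁻¹).viaFintypeEmbedding e = π' := by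
        rw [hmul, ← mul_assoc, heq, mul_assoc, ← hmul]; simp [hone]
      have h4 := h π h1.1 (τ * τ'⁻¹) (by rw [h3]; exact h2.1)
      have h5 : τ = τ' := by rwa [mul_inv_eq_one] at h4
      subst h5
      have := mul_right_cancel heq
      simp [this]
  simpa [Finset.card_product, Fintype.card_perm] using hc

theorem perm_strictMono_eq_one {m : ℕ} (ρ : Equiv.Perm (Fin m)) (h : StrictMono ρ) : ρ = 1 := by
  have : (h.orderIsoOfSurjective ρ ρ.surjective) = OrderIso.refl _ := Subsingleton.elim _ _
  ext i
  have := congrArg (fun f : Fin m ≃o Fin m => f i) this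
  simpa using congrArg Fin.val this

theorem card_mono_le {n m : ℕ} (e : Fin m ↪ Fin n) :
    (Finset.univ.filter (fun π : Equiv.Perm (Fin n) => StrictMono (fun i => π (e i)))).card
      * m.factorial ≤ n.factorial := by
  apply card_mul_fact_le e
  intro π hπ ρ hρ
  simp only [Finset.mem_filter, Finset.mem_univ, true_and, Equiv.Perm.mul_apply,
    Equiv.Perm.viaFintypeEmbedding_apply_image] at hπ hρ
  apply perm_strictMono_eq_one
  intro i j hij
  exact hπ.lt_iff_lt.1 (hρ hij)

theorem card_anti_le {n m : ℕ} (e : Fin m ↪ Fin n) :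
    (Finset.univ.filter (fun π : Equiv.Perm (Fin n) => StrictAnti (fun i => π (e i)))).card
      * m.factorial ≤ n.factorial := by
  apply card_mul_fact_le e
  intro π hπ ρ hρ
  simp only [Finset.mem_filter, Finset.mem_univ, true_and, Equiv.Perm.mul_apply,
    Equiv.Perm.viaFintypeEmbedding_apply_image] at hπ hρ
  apply perm_strictMono_eq_one
  intro i j hij
  exact hπ.lt_iff_gt.1 (hρ hij)

theorem two_pow_le_fact (P : ℕ) : 2 ^ P ≤ (P + 1).factorial := by
  induction P with
  | zero => simp
  | succ k ih =>
    rw [Nat.factorial_succ, pow_succ, mul_comm]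
    exact Nat.mul_le_mul (by omega) ih

theorem row_pos {s t n i P : ℕ} (hs : 1 ≤ s) (hn : n = s * t) (hi : i + P < t)
    (k : Fin (P + 1)) : (i + k) * s < n := by
  subst hn
  rw [mul_comm s t]
  exact Nat.mul_lt_mul_of_pos_right (by omega) hs

def rowEmb {s t n : ℕ} (hs : 1 ≤ s) (hn : n = s * t) (i P : ℕ) (hi : i + P < t) :
    Fin (P + 1) ↪ Fin n where
  toFun k := ⟨(i + k) * s, row_pos hs hn hi k⟩
  inj' := by
    intro a b hab
    simp only [Fin.mk.injEq] at hab
    have := Nat.eq_of_mul_eq_mul_right hs hab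
    exact Fin.ext (by omega)

theorem row_val {s t n : ℕ} (hs : 1 ≤ s) (hn : n = s * t) (i P : ℕ) (hi : i + P < t)
    (π : Equiv.Perm (Fin n)) (k : Fin (P + 1)) :
    row1 s (seqOf n π) (i + 1 + k) = (π (rowEmb hs hn i P hi k) : ℕ) + 1 := by
  have h := row_pos hs hn hi k
  have e1 : (i + 1 + (k : ℕ) - 1) * s + 1 - 1 = (i + k) * s := by
    rw [Nat.add_sub_cancel]; congr 1; omega
  simp only [row1, seqOf, e1, h, dif_pos, rowEmb]
  rfl

theorem bad_mono {s t n : ℕ} (hs : 1 ≤ s) (hn : n = s * t) (P : ℕ)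
    (π : Equiv.Perm (Fin n)) (h : ¬ NoRun (t-1) P (sig (row1 s (seqOf n π)))) (hP : 1 ≤ P) :
    ∃ i, ∃ hi : i + P < t, StrictMono (fun k => π (rowEmb hs hn i P hi k)) ∨
      StrictAnti (fun k => π (rowEmb hs hn i P hi k)) := by
  unfold NoRun at h
  push Not at h
  obtain ⟨i', h1, h2, h3⟩ := h
  obtain ⟨i, rfl⟩ : ∃ i, i' = i + 1 := ⟨i' - 1, by omega⟩
  have hi : i + P < t := by omega
  refine ⟨i, hi, ?_⟩
  have hconst : ∀ k, k < P → sig (row1 s (seqOf n π)) (i + 1 + k) =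
      sig (row1 s (seqOf n π)) (i + 1) := by
    intro k
    induction k with
    | zero => simp
    | succ k ih =>
      intro hk
      rw [← ih (by omega), h3 (i + 1 + k) (by omega) (by omega)]
      rfl
  have hr := row_val hs hn i P hi π
  have hstep : ∀ k : Fin P, sig (row1 s (seqOf n π)) (i + 1 + k) =
      if π (rowEmb hs hn i P hi k.castSucc) ≤ π (rowEmb hs hn i P hi k.succ) then 1 else 0 := by
    intro k
    have ha := hr k.castSucc
    have hb := hr k.succ
    simp only [Fin.val_castSucc, Fin.val_succ] at ha hb
    rw [sig, ha, add_assoc (i+1), hb]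
    simp only [Nat.add_le_add_iff_right, Fin.val_fin_le]
  have hne : ∀ k : Fin P, π (rowEmb hs hn i P hi k.castSucc) ≠ π (rowEmb hs hn i P hi k.succ) := by
    intro k hk
    have := (rowEmb hs hn i P hi).injective (π.injective hk)
    exact absurd this (Fin.castSucc_lt_succ).ne
  by_cases h0 : sig (row1 s (seqOf n π)) (i + 1) = 1
  · left
    rw [Fin.strictMono_iff_lt_succ]
    intro k
    have := hconst k k.2
    rw [h0, hstep] at this
    refine lt_of_le_of_ne ?_ (hne k)
    by_contra hc
    rw [if_neg hc] at this
    omega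
  · right
    rw [Fin.strictAnti_iff_succ_lt]
    intro k
    have := hconst k k.2
    rw [hstep] at this
    by_contra hc
    rw [if_pos (not_lt.1 hc)] at this
    exact h0 this.symm

open Classical in
theorem bad_card {s t n : ℕ} (hs : 1 ≤ s) (hn : n = s * t) (P : ℕ) (hP : 1 ≤ P)
    (ht : 4 * t ≤ (P + 1).factorial) :
    2 * (Finset.univ.filter (fun π : Equiv.Perm (Fin n) =>
      ¬ NoRun (t-1) P (sig (row1 s (seqOf n π))))).card ≤ n.factorial := by
  set B := Finset.univ.filter (fun π : Equiv.Perm (Fin n) =>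
      ¬ NoRun (t-1) P (sig (row1 s (seqOf n π)))) with hB
  let M : ℕ → Finset (Equiv.Perm (Fin n)) := fun i =>
    if hi : i + P < t then
      Finset.univ.filter (fun π => StrictMono (fun k => π (rowEmb hs hn i P hi k))) ∪
      Finset.univ.filter (fun π => StrictAnti (fun k => π (rowEmb hs hn i P hi k)))
    else ∅
  have hsub : B ⊆ (Finset.range t).biUnion M := by
    intro π hπ
    rw [hB, Finset.mem_filter] at hπ
    obtain ⟨i, hi, h⟩ := bad_mono hs hn P π hπ.2 hP
    rw [Finset.mem_biUnion]
    refine ⟨i, Finset.mem_range.2 (by omega), ?_⟩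
    simp only [M, dif_pos hi, Finset.mem_union, Finset.mem_filter, Finset.mem_univ, true_and]
    exact h
  have hM : ∀ i, (M i).card * (P+1).factorial ≤ 2 * n.factorial := by
    intro i
    by_cases hi : i + P < t
    · simp only [M, dif_pos hi]
      have h1 := card_mono_le (rowEmb hs hn i P hi)
      have h2 := card_anti_le (rowEmb hs hn i P hi)
      calc _ ≤ _ := Nat.mul_le_mul_right _ (Finset.card_union_le _ _)
        _ ≤ _ := by
          rw [add_mul, two_mul]
          refine add_le_add ?_ ?_
          · convert h1
          · convert h2
    · simp [M, hi]
  have h1 : B.card ≤ ∑ i ∈ Finset.range t, (M i).card :=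
    (Finset.card_le_card hsub).trans Finset.card_biUnion_le
  have h2 : B.card * (P+1).factorial ≤ t * (2 * n.factorial) := by
    calc _ ≤ (∑ i ∈ Finset.range t, (M i).card) * (P+1).factorial := Nat.mul_le_mul_right _ h1
      _ = ∑ i ∈ Finset.range t, (M i).card * (P+1).factorial := Finset.sum_mul _ _ _
      _ ≤ ∑ i ∈ Finset.range t, 2 * n.factorial := Finset.sum_le_sum (fun i _ => hM i)
      _ = _ := by simp
  rcases Nat.eq_zero_or_pos t with rfl | htp
  · have : B.card = 0 := by simpa using h2.trans (by simp)|>.antisymm (Nat.zero_le _)|> fun h => (Nat.mul_eq_zero.1 h).resolve_right (Nat.factorial_ne_zero _)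
    omega
  · have h3 : B.card * (4 * t) ≤ t * (2 * n.factorial) := (Nat.mul_le_mul_left _ ht).trans h2
    have h4 : t * (2 * (2 * B.card)) ≤ t * (2 * n.factorial) := by linarith
    have := Nat.le_of_mul_le_mul_left h4 htp
    omega

theorem pigeon {A B : Type*} [DecidableEq B] (G : Finset A) (T : Finset B) (hT : T.Nonempty)
    (f : A → B) (hf : ∀ x ∈ G, f x ∈ T) :
    ∃ b ∈ T, G.card ≤ T.card * (G.filter (fun x => f x = b)).card := by
  obtain ⟨b, hb, hmax⟩ := Finset.exists_max_image T
    (fun b => (G.filter (fun x => f x = b)).card) hT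
  refine ⟨b, hb, ?_⟩
  rw [Finset.card_eq_sum_card_fiberwise hf]
  simpa using Finset.sum_le_sum hmax

/-- Theorem: there is a choice of parameters for which C_s^1 has size
at least n! / (2 · (n/s) · (2Ps)² · ((2s)!)²). -/
theorem stmt8 (s t n : ℕ) (hs : 1 ≤ s) (ht : Even t) (ht1 : 1 ≤ t) (hn : n = s * t)
    (P : ℕ) (hP : P = Nat.clog 2 (4*n/s)) (hdvd : 2*P*s ∣ n) :
    ∃ a < t, ∃ c1 < 2*P*s, ∃ c2 < 2*P*s,
      ∃ d1 < Nat.factorial (2*s), ∃ d2 < Nat.factorial (2*s),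
      Nat.factorial n ≤
        2 * (n/s) * (2*P*s)^2 * (Nat.factorial (2*s))^2 *
          Nat.card {π : Equiv.Perm (Fin n) //
            ((∑ i ∈ Finset.Icc 1 (t-1), i * sig (row1 s (seqOf n π)) i) ≡ a [MOD t])
            ∧ NoRun (t-1) P (sig (row1 s (seqOf n π)))
            ∧ CRetrieve n s P c1 c2 (seqOf n π)
            ∧ CRecover n s d1 d2 (seqOf n π)} := by
  classical
  have htt : n / s = t := by rw [hn]; exact Nat.mul_div_cancel_left t hs
  have h4 : 4 * n / s = 4 * t := by
    rw [hn, show 4 * (s * t) = s * (4 * t) by ring]; exact Nat.mul_div_cancel_left _ hs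
  have hpow : 4 * t ≤ 2 ^ P := by
    rw [hP, h4]; exact Nat.le_pow_clog (by norm_num) _
  have hP1 : 1 ≤ P := by
    rcases Nat.eq_zero_or_pos P with h | h
    · rw [h] at hpow; simp at hpow; omega
    · exact h
  have hbad := bad_card hs hn P hP1 (hpow.trans (two_pow_le_fact P))
  have hq : 0 < 2 * P * s := by positivity
  have hF : 0 < (2 * s).factorial := Nat.factorial_pos _
  set G := Finset.univ.filter (fun π : Equiv.Perm (Fin n) =>
      NoRun (t-1) P (sig (row1 s (seqOf n π)))) with hG
  have hGB := Finset.card_filter_add_card_filter_not (s := (Finset.univ : Finset (Equiv.Perm (Fin n))))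
    (fun π : Equiv.Perm (Fin n) => NoRun (t-1) P (sig (row1 s (seqOf n π))))
  rw [Finset.card_univ, Fintype.card_perm, Fintype.card_fin, ← hG] at hGB
  let f : Equiv.Perm (Fin n) → ℕ × ℕ × ℕ × ℕ × ℕ := fun π =>
    ((∑ i ∈ Finset.Icc 1 (t-1), i * sig (row1 s (seqOf n π)) i) % t,
     (∑ i ∈ Finset.Icc 1 (n/(2*P*s)),
      rowSumBeta s P (pairBlk (seqOf n π) (P*s) (n/(P*s)) (2*i-1))) % (2*P*s),
     (∑ i ∈ Finset.Icc 1 (n/(2*P*s)),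
      rowSumBeta s P (pairBlk (seqOf n π) (P*s) (n/(P*s)) (2*i))) % (2*P*s),
     (∑ i ∈ Finset.Icc 1 (n/(2*s)), permRank (pairBlk (seqOf n π) s (n/s) (2*i-1)) (2*s))
       % (2*s).factorial,
     (∑ i ∈ Finset.Icc 1 (n/(2*s)), permRank (pairBlk (seqOf n π) s (n/s) (2*i)) (2*s))
       % (2*s).factorial)
  let T := Finset.range t ×ˢ Finset.range (2*P*s) ×ˢ Finset.range (2*P*s) ×ˢ
    Finset.range (2*s).factorial ×ˢ Finset.range (2*s).factorial
  have hfT : ∀ x ∈ G, f x ∈ T := by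
    intro x _
    simp only [f, T, Finset.mem_product, Finset.mem_range]
    exact ⟨Nat.mod_lt _ ht1, Nat.mod_lt _ hq, Nat.mod_lt _ hq, Nat.mod_lt _ hF, Nat.mod_lt _ hF⟩
  have hTn : T.Nonempty := by
    refine ⟨(0, 0, 0, 0, 0), ?_⟩
    simp only [T, Finset.mem_product, Finset.mem_range]
    exact ⟨ht1, hq, hq, hF, hF⟩
  obtain ⟨⟨a, c1, c2, d1, d2⟩, hb, hcard⟩ := pigeon G T hTn f hfT
  have hTc : T.card = t * (2*P*s)^2 * (2*s).factorial^2 := by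
    simp only [T, Finset.card_product, Finset.card_range]; ring
  simp only [T, Finset.mem_product, Finset.mem_range] at hb
  obtain ⟨ha, hc1, hc2, hd1, hd2⟩ := hb
  refine ⟨a, ha, c1, hc1, c2, hc2, d1, hd1, d2, hd2, ?_⟩
  have hle : (G.filter (fun x => f x = (a, c1, c2, d1, d2))).card ≤
      Nat.card {π : Equiv.Perm (Fin n) //
            ((∑ i ∈ Finset.Icc 1 (t-1), i * sig (row1 s (seqOf n π)) i) ≡ a [MOD t])
            ∧ NoRun (t-1) P (sig (row1 s (seqOf n π)))
            ∧ CRetrieve n s P c1 c2 (seqOf n π)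
            ∧ CRecover n s d1 d2 (seqOf n π)} := by
    rw [Nat.card_eq_fintype_card, Fintype.card_subtype]
    apply Finset.card_le_card
    intro π hπ
    simp only [hG, f, Finset.mem_filter, Finset.mem_univ, true_and, Prod.mk.injEq] at hπ ⊢
    obtain ⟨h0, h1, h2, h3, h4, h5⟩ := hπ
    unfold CRetrieve CRecover Nat.ModEq
    rw [Nat.mod_eq_of_lt ha, Nat.mod_eq_of_lt hc1, Nat.mod_eq_of_lt hc2, Nat.mod_eq_of_lt hd1,
      Nat.mod_eq_of_lt hd2]
    exact ⟨h1, h0, ⟨h2, h3⟩, h4, h5⟩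
  have hfin := hcard.trans (Nat.mul_le_mul_left _ hle)
  rw [hTc] at hfin
  rw [htt]
  calc n.factorial ≤ 2 * G.card := by omega
    _ ≤ _ := Nat.mul_le_mul_left 2 hfin
    _ = _ := by ring

end Stmt
end
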